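/- For every d ≥ 2 there exists a constant C_d > 0 depending only on d such that for every positive integer t and every integer N ≥ C_d · t^d there exists a spherical t-design on S^d consisting of exactly N points. -/

import Mathlib

open MeasureTheory

/-- The normalised surface area measure `σ_d` on the unit sphere `S^d ⊂ ℝ^{d+1}`. -/
noncomputable def sphereMeasure (d : ℕ) :
    Measure (EuclideanSpace ℝ (Fin (d + 1))) :=
  (μH[(d : ℝ)] (Metric.sphere (0 : EuclideanSpace ℝ (Fin (d + 1))) 1))⁻¹ •
    (μH[(d : ℝ)]).restrict (Metric.sphere (0 : EuclideanSpace ℝ (Fin (d + 1))) 1)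

/-- A finite set `X ⊂ S^d` is a spherical `t`-design if the equal-weight average over `X`
of every polynomial of total degree at most `t` equals its integral over `S^d`. -/
def IsSphericalDesign (d t : ℕ) (X : Finset (EuclideanSpace ℝ (Fin (d + 1)))) : Prop :=
  ∀ p : MvPolynomial (Fin (d + 1)) ℝ, p.totalDegree ≤ t →
    (X.card : ℝ)⁻¹ * ∑ x ∈ X, MvPolynomial.eval (fun i => x i) p =
      ∫ y, MvPolynomial.eval (fun i => y i) p ∂(sphereMeasure d)

section BrouwerPart

lemma det_lagrange (n : ℕ) (v : Fin (n+1) → ℝ) (hv : Function.Injective v) :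
    ∃ l : Fin (n+1) → ℝ, (∑ i, l i = 1) ∧
      ∀ A : EuclideanSpace ℝ (Fin n) →L[ℝ] EuclideanSpace ℝ (Fin n),
        ((1 : EuclideanSpace ℝ (Fin n) →L[ℝ] EuclideanSpace ℝ (Fin n)) + A).det
          = ∑ i, l i * (1 + v i • A).det := by
  classical
  refine ⟨fun i => (Lagrange.basis Finset.univ v i).eval 1, ?_, ?_⟩
  · have := Lagrange.sum_basis (s := (Finset.univ : Finset (Fin (n+1)))) (v := v)
      hv.injOn ⟨0, Finset.mem_univ _⟩
    rw [← Polynomial.eval_finsetSum, this, Polynomial.eval_one]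
  · intro A
    let b := (EuclideanSpace.basisFun (Fin n) ℝ).toBasis
    let M := LinearMap.toMatrix b b (A : EuclideanSpace ℝ (Fin n) →ₗ[ℝ] EuclideanSpace ℝ (Fin n))
    let p : Polynomial ℝ := ((Polynomial.X : Polynomial ℝ) • M.map Polynomial.C
      + (1 : Matrix (Fin n) (Fin n) ℝ).map Polynomial.C).det
    have hp : ∀ τ : ℝ, p.eval τ = (1 + τ • A).det := by
      intro τ
      have h1 : p.eval τ = (τ • M + 1).det := by
        have := RingHom.map_det (Polynomial.evalRingHom τ) ((Polynomial.X : Polynomial ℝ) • M.map Polynomial.C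
          + (1 : Matrix (Fin n) (Fin n) ℝ).map Polynomial.C)
        rw [Polynomial.coe_evalRingHom] at this
        simp only [p]
        rw [this]
        congr 1
        ext i j
        by_cases hij : i = j <;> simp [hij] <;> exact mul_comm _ _
      rw [h1, ContinuousLinearMap.det, ← LinearMap.det_toMatrix b]
      congr 1
      simp [M, add_comm]
    have hdeg : p.degree < (Finset.univ : Finset (Fin (n+1))).card := by
      have h := Polynomial.natDegree_det_X_add_C_le M 1
      rw [Fintype.card_fin] at h
      rw [Finset.card_univ, Fintype.card_fin]
      refine lt_of_le_of_lt Polynomial.degree_le_natDegree ?_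
      exact_mod_cast Nat.lt_succ_of_le h
    have h2 := Lagrange.eq_interpolate (s := (Finset.univ : Finset (Fin (n+1)))) (v := v)
      hv.injOn hdeg
    have h3 := congrArg (Polynomial.eval 1) h2
    rw [hp 1, one_smul, Lagrange.interpolate_apply, Polynomial.eval_finsetSum] at h3
    rw [h3]
    refine Finset.sum_congr rfl fun i _ => ?_
    simp [hp, mul_comm]

lemma det_pos_of_small {n : ℕ} (A : EuclideanSpace ℝ (Fin n) →L[ℝ] EuclideanSpace ℝ (Fin n))
    (h : ‖A‖ < 1) : 0 < (1 + A).det := by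
  have hne : ∀ τ ∈ Set.Icc (0:ℝ) 1, (1 + τ • A).det ≠ 0 := by
    intro τ hτ h0
    have hu : IsUnit (1 - (-(τ • A))) := by
      apply isUnit_one_sub_of_norm_lt_one
      rw [norm_neg, norm_smul, Real.norm_eq_abs, abs_of_nonneg hτ.1]
      nlinarith [norm_nonneg A, hτ.2]
    rw [sub_neg_eq_add] at hu
    have h2 := LinearMap.isUnit_det _ (hu.map (ContinuousLinearMap.toLinearMapRingHom (M₁ := EuclideanSpace ℝ (Fin n)) (R₁ := ℝ)))
    exact h2.ne_zero h0
  have hc : Continuous fun τ : ℝ => (1 + τ • A).det :=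
    ContinuousLinearMap.continuous_det.comp (by fun_prop)
  by_contra hneg
  push Not at hneg
  have := intermediate_value_Icc' (zero_le_one' ℝ) hc.continuousOn
  have h0 : (0:ℝ) ∈ Set.Icc ((1 + (1:ℝ) • A).det) ((1 + (0:ℝ) • A).det) := by
    refine ⟨by simpa using hneg, ?_⟩
    simp [ContinuousLinearMap.det]
  obtain ⟨τ, hτ, h⟩ := this h0
  exact hne τ hτ h

lemma no_retract {n : ℕ} (g : EuclideanSpace ℝ (Fin n) → EuclideanSpace ℝ (Fin n)) (K : NNReal)
    (hK : LipschitzWith K g) (hout : ∀ x, 1 ≤ ‖x‖ → g x = 0)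
    (g' : EuclideanSpace ℝ (Fin n) → EuclideanSpace ℝ (Fin n) →L[ℝ] EuclideanSpace ℝ (Fin n))
    (hd : ∀ x ∈ Metric.ball (0 : EuclideanSpace ℝ (Fin n)) 1, HasFDerivAt g (g' x) x)
    (hs : ∀ x ∈ Metric.ball (0 : EuclideanSpace ℝ (Fin n)) 1, ‖x + g x‖ = 1) : False := by
  set B := Metric.ball (0 : EuclideanSpace ℝ (Fin n)) 1 with hB
  -- nodes
  let v : Fin (n+1) → ℝ := fun i => 1 / ((K + 1) * ((i:ℝ) + 2))
  have hKp : (0:ℝ) < K + 1 := by positivity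
  have hvpos : ∀ i, 0 < v i := fun i => by positivity
  have hvK : ∀ i, v i * K < 1 := by
    intro i
    simp only [v]
    rw [one_div, inv_mul_lt_iff₀ (by positivity)]
    have : (0:ℝ) ≤ (i:ℝ) := by positivity
    nlinarith [K.coe_nonneg]
  have hvinj : Function.Injective v := by
    intro i j hij
    simp only [v] at hij
    field_simp at hij
    have : (i:ℝ) = j := by linarith
    exact Fin.ext (by exact_mod_cast this)
  have hnorm : ∀ x ∈ B, ‖g' x‖ ≤ K := fun x hx => (hd x hx).le_of_lipschitz hK
  -- maps
  have key : ∀ i, IntegrableOn (fun x => (1 + v i • g' x).det) B volume ∧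
      ∫ x in B, (1 + v i • g' x).det = (volume B).toReal := by
    intro i
    set τ := v i
    let f : EuclideanSpace ℝ (Fin n) → EuclideanSpace ℝ (Fin n) := fun x => x + τ • g x
    have hap : ApproximatesLinearOn f
        ((ContinuousLinearEquiv.refl ℝ (EuclideanSpace ℝ (Fin n)) : EuclideanSpace ℝ (Fin n) →L[ℝ] EuclideanSpace ℝ (Fin n))) Set.univ (Real.toNNReal τ * K) := by
      intro x _ y _
      have : f x - f y - (ContinuousLinearEquiv.refl ℝ (EuclideanSpace ℝ (Fin n)) : EuclideanSpace ℝ (Fin n) →L[ℝ] EuclideanSpace ℝ (Fin n)) (x - y) = τ • (g x - g y) := by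
        simp [f, smul_sub]; abel
      rw [this, norm_smul, Real.norm_eq_abs, abs_of_pos (hvpos i)]
      have h1 := hK.norm_sub_le x y
      calc τ * ‖g x - g y‖ ≤ τ * (K * ‖x - y‖) := by gcongr
        _ = _ := by
          rw [NNReal.coe_mul, Real.coe_toNNReal _ (hvpos i).le, mul_assoc]
    have hinj : Function.Injective f := by
      intro x y hxy
      have h1 : x - y = τ • (g y - g x) := by
        have : x + τ • g x = y + τ • g y := hxy
        rw [smul_sub]
        rw [sub_eq_sub_iff_add_eq_add]; rw [this]; abel
      have h2 : ‖x - y‖ ≤ τ * K * ‖x - y‖ := by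
        calc ‖x - y‖ = τ * ‖g y - g x‖ := by
              rw [h1, norm_smul, Real.norm_eq_abs, abs_of_pos (hvpos i)]
          _ ≤ τ * (K * ‖y - x‖) := by
              gcongr
              exact hK.norm_sub_le y x
          _ = _ := by rw [norm_sub_rev]; ring
      have h3 : ‖x - y‖ = 0 := by
        have := hvK i
        nlinarith [norm_nonneg (x - y)]
      exact sub_eq_zero.mp (norm_eq_zero.mp h3)
    have hsurj : Function.Surjective f := by
      refine hap.surjective ?_
      by_cases hsub : Subsingleton (EuclideanSpace ℝ (Fin n))
      · left; exact hsub
      · right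
        have : Nontrivial (EuclideanSpace ℝ (Fin n)) := not_subsingleton_iff_nontrivial.mp hsub
        rw [← NNReal.coe_lt_coe]
        simp
        rw [max_eq_left (hvpos i).le]
        exact hvK i
    have himg : f '' B = B := by
      have hfix : ∀ x, x ∉ B → f x = x := by
        intro x hx
        have : g x = 0 := hout x (by simpa [hB] using hx)
        simp [f, this]
      ext y
      constructor
      · rintro ⟨x, hx, rfl⟩
        by_contra hy
        have := hfix _ hy
        exact hy (by rw [hinj this]; exact hx)
      · intro hy
        obtain ⟨x, rfl⟩ := hsurj y
        refine ⟨x, ?_, rfl⟩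
        by_contra hx
        rw [hfix x hx] at hy; exact hx hy
    have hder : ∀ x ∈ B, HasFDerivWithinAt f (1 + τ • g' x) B x := by
      intro x hx
      exact ((hasFDerivAt_id x).add ((hd x hx).const_smul τ)).hasFDerivWithinAt
    have hpos : ∀ x ∈ B, 0 < (1 + τ • g' x).det := by
      intro x hx
      apply det_pos_of_small
      rw [norm_smul, Real.norm_eq_abs, abs_of_pos (hvpos i)]
      exact lt_of_le_of_lt (mul_le_mul_of_nonneg_left (hnorm x hx) (hvpos i).le) (hvK i)
    have hmB : MeasurableSet B := measurableSet_ball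
    have h1 := integrableOn_image_iff_integrableOn_abs_det_fderiv_smul volume hmB hder hinj.injOn
      (fun _ => (1:ℝ))
    have h2 := integral_image_eq_integral_abs_det_fderiv_smul volume hmB hder hinj.injOn
      (fun _ => (1:ℝ))
    rw [himg] at h1 h2
    have heq : Set.EqOn (fun x => |(1 + τ • g' x).det| • (1:ℝ)) (fun x => (1 + τ • g' x).det) B := by
      intro x hx
      simp [abs_of_pos (hpos x hx)]
    have hfin : volume B ≠ ⊤ := measure_ball_lt_top.ne
    constructor
    · exact (h1.mp (integrableOn_const hfin)).congr_fun heq hmB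
    · rw [← setIntegral_congr_fun hmB heq, ← h2]
      simp [Measure.real]
  obtain ⟨l, hl1, hl⟩ := det_lagrange n v hvinj
  have hzero : ∀ x ∈ B, (1 + g' x).det = 0 := by
    intro x hx
    by_contra hne
    have hsur : Function.Surjective ⇑((1 : EuclideanSpace ℝ (Fin n) →L[ℝ] EuclideanSpace ℝ (Fin n)) + g' x) := by
      have := LinearEquiv.surjective (LinearMap.equivOfDetNeZero _ hne)
      exact this
    obtain ⟨w, hw⟩ := hsur (x + g x)
    have hr : HasFDerivAt (fun y => y + g y) (1 + g' x) x := (hasFDerivAt_id x).add (hd x hx)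
    have h2 := hr.norm_sq
    have h3 : HasFDerivAt (fun y => ‖y + g y‖ ^ 2) (0 : EuclideanSpace ℝ (Fin n) →L[ℝ] ℝ) x := by
      have : (fun y => ‖y + g y‖ ^ 2) =ᶠ[nhds x] fun _ => (1:ℝ) := by
        filter_upwards [Metric.isOpen_ball.mem_nhds hx] with y hy
        rw [hs y hy]; norm_num
      exact (hasFDerivAt_const (1:ℝ) x).congr_of_eventuallyEq this
    have h4 := DFunLike.congr_fun (h2.unique h3) w
    have h5 : (inner ℝ (x + g x) ((1 + g' x) w) : ℝ) = 0 := by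
      have h6 : (2 : ℕ) • (inner ℝ (x + g x) ((1 + g' x) w) : ℝ) = 0 := h4
      rw [nsmul_eq_mul] at h6
      exact (mul_eq_zero.mp h6).resolve_left (by norm_num)
    rw [hw, real_inner_self_eq_norm_sq, hs x hx] at h5
    norm_num at h5
  have h1 : ∫ x in B, (1 + g' x).det = (volume B).toReal := by
    rw [show (fun x => (1 + g' x).det) = fun x => ∑ i, l i * (1 + v i • g' x).det from funext fun x => hl _]
    rw [integral_finsetSum _ (fun i _ => ((key i).1.const_mul _))]
    simp_rw [integral_const_mul, (key _).2, ← Finset.sum_mul, hl1, one_mul]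
  have h0 : ∫ x in B, (1 + g' x).det = 0 := by
    rw [setIntegral_congr_fun measurableSet_ball (g := fun _ => (0:ℝ)) hzero]; simp
  have hpos : 0 < (volume B).toReal :=
    ENNReal.toReal_pos (Metric.measure_ball_pos _ _ one_pos).ne' measure_ball_lt_top.ne
  linarith

end BrouwerPart

section BrouwerPart2

lemma smooth_zero {n : ℕ} (F : EuclideanSpace ℝ (Fin n) → EuclideanSpace ℝ (Fin n))
    (hF : ContDiff ℝ 1 F) (hpos : ∀ x, ‖x‖ = 1 → 0 < (inner ℝ x (F x) : ℝ)) :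
    ∃ x, ‖x‖ ≤ 1 ∧ F x = 0 := by
  by_contra hcon
  push Not at hcon
  let q : EuclideanSpace ℝ (Fin n) → ℝ := fun x =>
    (inner ℝ x (F x)) ^ 2 + ‖F x‖ ^ 2 * (1 - ‖x‖ ^ 2)
  let lam : EuclideanSpace ℝ (Fin n) → ℝ := fun x =>
    (-(inner ℝ x (F x)) + Real.sqrt (q x)) / ‖F x‖ ^ 2
  let G : EuclideanSpace ℝ (Fin n) → EuclideanSpace ℝ (Fin n) := fun x => lam x • F x
  have hFn : ∀ x, ‖x‖ ≤ 1 → 0 < ‖F x‖ ^ 2 := fun x hx => by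
    have := norm_pos_iff.mpr (hcon x hx); positivity
  have hq : ∀ x, ‖x‖ ≤ 1 → 0 < q x := by
    intro x hx
    rcases hx.lt_or_eq with h | h
    · have h1 := hFn x hx
      have : 0 < 1 - ‖x‖ ^ 2 := by nlinarith [norm_nonneg x]
      simp only [q]; positivity
    · have h1 := hpos x h
      simp only [q, h]; norm_num; positivity
  have hCD : ∀ x, ‖x‖ ≤ 1 → ContDiffAt ℝ 1 G x := by
    intro x hx
    have hFx : ContDiffAt ℝ 1 F x := hF.contDiffAt
    have h1 : ContDiffAt ℝ 1 (fun y => (inner ℝ y (F y) : ℝ)) x := contDiffAt_id.inner ℝ hFx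
    have h2 : ContDiffAt ℝ 1 (fun y => ‖F y‖ ^ 2) x := hFx.norm_sq ℝ
    have h3 : ContDiffAt ℝ 1 (fun y : EuclideanSpace ℝ (Fin n) => ‖y‖ ^ 2) x := contDiffAt_id.norm_sq ℝ
    have h4 : ContDiffAt ℝ 1 q x := (h1.pow 2).add (h2.mul (contDiffAt_const.sub h3))
    have h5 := h4.sqrt (hq x hx).ne'
    exact ((h1.neg.add h5).div h2 (hFn x hx).ne').smul hFx
  have hGS : ∀ x, ‖x‖ = 1 → G x = 0 := by
    intro x hx
    have : lam x = 0 := by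
      simp only [lam, q, hx]
      norm_num
      left
      rw [Real.sqrt_sq (hpos x hx).le]; ring
    simp [G, this]
  obtain ⟨K, hKL⟩ : ∃ K, LipschitzOnWith K G (Metric.closedBall 0 1) := by
    apply LocallyLipschitzOn.exists_lipschitzOnWith_of_compact (isCompact_closedBall _ _)
    intro x hx
    obtain ⟨K, t, ht, h⟩ := (hCD x (by simpa using hx)).exists_lipschitzOnWith
    exact ⟨K, t, mem_nhdsWithin_of_mem_nhds ht, h⟩
  classical
  let g : EuclideanSpace ℝ (Fin n) → EuclideanSpace ℝ (Fin n) := fun x => if ‖x‖ < 1 then G x else 0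
  have hgG : ∀ x, ‖x‖ ≤ 1 → g x = G x := by
    intro x hx
    by_cases h : ‖x‖ < 1
    · simp [g, h]
    · simp [g, h, hGS x (le_antisymm hx (not_lt.mp h))]
  have hmix : ∀ x y, ‖x‖ ≤ 1 → 1 < ‖y‖ → dist (g x) (g y) ≤ K * dist x y := by
    intro x y hx hy
    have hc : Continuous fun s : ℝ => ‖AffineMap.lineMap x y s‖ :=
      (AffineMap.lineMap_continuous).norm
    obtain ⟨s, hs, hz⟩ := intermediate_value_Icc (zero_le_one' ℝ) hc.continuousOn
      (show (1:ℝ) ∈ Set.Icc _ _ from ⟨by simpa using hx, by simpa using hy.le⟩)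
    set z := AffineMap.lineMap x y s
    have hz1 : ‖z‖ = 1 := hz
    have h1 : g y = g z := by
      rw [hgG z hz1.le, hGS z hz1]; simp [g, hy.le]
    rw [h1, hgG x hx, hgG z hz1.le]
    refine (hKL.dist_le_mul x (by simpa using hx) z (by simpa using hz1.le)).trans ?_
    gcongr
    rw [dist_left_lineMap, Real.norm_eq_abs, abs_of_nonneg hs.1]
    exact mul_le_of_le_one_left dist_nonneg hs.2
  have hlip : LipschitzWith K g := by
    apply LipschitzWith.of_dist_le_mul
    intro x y
    rcases le_or_gt ‖x‖ 1 with hx | hx <;> rcases le_or_gt ‖y‖ 1 with hy | hy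
    · rw [hgG x hx, hgG y hy]
      exact hKL.dist_le_mul x (by simpa using hx) y (by simpa using hy)
    · exact hmix x y hx hy
    · rw [dist_comm, dist_comm x]; exact hmix y x hy hx
    · simp [g, hx.le, hy.le, not_lt.mpr]
      positivity
  refine no_retract g K hlip (fun x hx => by simp [g, not_lt.mpr hx]) (fun x => fderiv ℝ G x) ?_ ?_
  · intro x hx
    have hx1 : ‖x‖ < 1 := by simpa using hx
    have := ((hCD x hx1.le).differentiableAt one_ne_zero).hasFDerivAt
    refine this.congr_of_eventuallyEq ?_
    filter_upwards [Metric.isOpen_ball.mem_nhds hx] with y hy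
    exact hgG y (by have : ‖y‖ < 1 := by simpa using hy
                    exact this.le)
  · intro x hx
    have hx1 : ‖x‖ < 1 := by simpa using hx
    rw [hgG x hx1.le]
    have h1 : ‖x + G x‖ ^ 2 = 1 := by
      rw [norm_add_sq_real]
      simp only [G, inner_smul_right, norm_smul, mul_pow, Real.norm_eq_abs, sq_abs]
      have hF0 := hFn x hx1.le
      have hsq := Real.sq_sqrt (hq x hx1.le).le
      have hl : lam x * ‖F x‖ ^ 2 = -(inner ℝ x (F x)) + Real.sqrt (q x) := by
        simp only [lam]; exact div_mul_cancel₀ _ hF0.ne'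
      have h2 : (lam x * ‖F x‖ ^ 2 + inner ℝ x (F x)) ^ 2 = q x := by
        rw [hl]; ring_nf; ring_nf at hsq; exact hsq
      simp only [q] at h2
      have h3 : ‖F x‖ ^ 2 * (‖x‖ ^ 2 + 2 * (lam x * inner ℝ x (F x)) + lam x ^ 2 * ‖F x‖ ^ 2 - 1) = 0 := by
        linarith [h2]
      have := (mul_eq_zero.mp h3).resolve_left hF0.ne'
      linarith
    have := norm_nonneg (x + G x)
    nlinarith

lemma bz_continuous_zero {n : ℕ} (F : EuclideanSpace ℝ (Fin n) → EuclideanSpace ℝ (Fin n))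
    (hF : Continuous F) (hpos : ∀ x, ‖x‖ = 1 → 0 < (inner ℝ x (F x) : ℝ)) :
    ∃ x, ‖x‖ ≤ 1 ∧ F x = 0 := by
  by_contra hcon
  push Not at hcon
  have hc1 : IsCompact (Metric.closedBall (0 : EuclideanSpace ℝ (Fin n)) 1) := isCompact_closedBall _ _
  have hc2 : IsCompact (Metric.sphere (0 : EuclideanSpace ℝ (Fin n)) 1) := isCompact_sphere _ _
  obtain ⟨x0, hx0, hm⟩ := hc1.exists_isMinOn ⟨0, by simp⟩ hF.norm.continuousOn
  have h0 : 0 < ‖F x0‖ := norm_pos_iff.mpr (hcon x0 (by simpa using hx0))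
  obtain ⟨e, he, hes⟩ : ∃ e > 0, ∀ x, ‖x‖ = 1 → e ≤ (inner ℝ x (F x) : ℝ) := by
    by_cases hne : (Metric.sphere (0 : EuclideanSpace ℝ (Fin n)) 1).Nonempty
    · obtain ⟨x1, hx1, hm1⟩ := hc2.exists_isMinOn hne
        (continuous_id.inner hF : Continuous fun x => (inner ℝ x (F x) : ℝ)).continuousOn
      refine ⟨_, hpos x1 (by simpa using hx1), fun x hx => hm1 (by simpa using hx)⟩
    · refine ⟨1, one_pos, fun x hx => ?_⟩
      exact absurd ⟨x, by simpa using hx⟩ hne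
  obtain ⟨G, hG, hGF, -⟩ := hF.exists_contDiff_approx 1 (ε := fun _ => min ‖F x0‖ e)
    continuous_const (fun _ => lt_min h0 he)
  obtain ⟨x, hx, hGx⟩ := smooth_zero G (by exact_mod_cast hG) (by
    intro x hx
    have h1 := hes x hx
    have h2 := hGF x
    rw [dist_eq_norm] at h2
    have h3 := abs_real_inner_le_norm x (G x - F x)
    rw [hx, one_mul, inner_sub_right] at h3
    have := (abs_le.mp h3).1
    have := lt_of_lt_of_le h2 (min_le_right _ _)
    linarith)
  have h2 := hGF x
  rw [hGx, dist_zero_left] at h2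
  have h3 : ‖F x0‖ ≤ ‖F x‖ := hm (by simpa using hx)
  exact absurd (lt_of_lt_of_le h2 (min_le_left _ _)) (not_lt.mpr h3)

/-- Zero of a continuous map pointing outwards on the boundary of a star-shaped domain. -/
lemma bz_star_zero {n : ℕ} (F : EuclideanSpace ℝ (Fin n) → EuclideanSpace ℝ (Fin n))
    (hF : Continuous F) (M : EuclideanSpace ℝ (Fin n) → ℝ) (hM : Continuous M)
    (hhom : ∀ (a : ℝ) x, M (a • x) = |a| * M x) (hMpos : ∀ x, x ≠ 0 → 0 < M x)
    (hpos : ∀ x, M x = 1 → 0 < (inner ℝ x (F x) : ℝ)) :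
    ∃ x, M x ≤ 1 ∧ F x = 0 := by
  let ψ : EuclideanSpace ℝ (Fin n) → EuclideanSpace ℝ (Fin n) := fun u => (‖u‖ / M u) • u
  have hM0 : M 0 = 0 := by simpa using hhom 0 0
  have hψM : ∀ u, M (ψ u) = ‖u‖ := by
    intro u
    by_cases hu : u = 0
    · simp [hu, ψ, hM0]
    · have := hMpos u hu
      simp only [ψ]
      rw [hhom, abs_of_nonneg (by positivity)]; field_simp
  obtain ⟨e, he, hes⟩ : ∃ e > 0, ∀ x, e * ‖x‖ ≤ M x := by
    by_cases hne : (Metric.sphere (0 : EuclideanSpace ℝ (Fin n)) 1).Nonempty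
    · obtain ⟨x1, hx1, hm1⟩ := (isCompact_sphere (0 : EuclideanSpace ℝ (Fin n)) 1).exists_isMinOn hne
        hM.continuousOn
      have hx1' : ‖x1‖ = 1 := by simpa using hx1
      refine ⟨M x1, hMpos x1 (by intro h; simp [h] at hx1'), fun x => ?_⟩
      by_cases hx : x = 0
      · simp [hx, hM0]
      · have hxn := norm_pos_iff.mpr hx
        have h1 : M x1 ≤ M (‖x‖⁻¹ • x) := hm1 (by simp [norm_smul, hxn.ne'])
        rw [hhom, abs_of_pos (by positivity), inv_mul_eq_div, le_div_iff₀ hxn] at h1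
        exact h1
    · refine ⟨1, one_pos, fun x => ?_⟩
      by_cases hx : x = 0
      · simp [hx, hM0]
      · have hxn := norm_pos_iff.mpr hx
        exact absurd ⟨‖x‖⁻¹ • x, by simp [norm_smul, hxn.ne']⟩ hne
  have hψc : Continuous ψ := by
    rw [continuous_iff_continuousAt]
    intro u
    by_cases hu : u = 0
    · subst hu
      have hb : ∀ u, ‖ψ u‖ ≤ e⁻¹ * ‖u‖ := by
        intro u
        by_cases hu : u = 0
        · simp [hu, ψ]
        · have h1 := hMpos u hu
          have h2 := hes u
          have h3 := norm_pos_iff.mpr hu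
          simp only [ψ]
          rw [norm_smul, Real.norm_eq_abs, abs_of_pos (by positivity)]
          gcongr
          rw [div_le_iff₀ h1, inv_mul_eq_div, le_div_iff₀ he]; linarith
      have h0 : ψ 0 = 0 := by simp [ψ]
      rw [ContinuousAt, h0]
      apply squeeze_zero_norm hb
      have : Continuous fun u : EuclideanSpace ℝ (Fin n) => e⁻¹ * ‖u‖ := by fun_prop
      simpa using this.tendsto 0
    · exact (continuousAt_id.norm.div hM.continuousAt (hMpos u hu).ne').smul continuousAt_id
  obtain ⟨u, hu, hFu⟩ := bz_continuous_zero (F ∘ ψ) (hF.comp hψc) (by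
    intro u hu
    have hu0 : u ≠ 0 := by intro h; simp [h] at hu
    have h1 := hpos (ψ u) (by rw [hψM, hu])
    have h2 := hMpos u hu0
    have h3 : (inner ℝ (ψ u) (F (ψ u)) : ℝ) = (1 / M u) * inner ℝ u (F (ψ u)) := by
      generalize F (ψ u) = z
      rw [show ψ u = (‖u‖ / M u) • u from rfl, real_inner_smul_left, hu]
    rw [h3] at h1
    exact (pos_iff_pos_of_mul_pos h1).mp (by positivity))
  exact ⟨ψ u, by rw [hψM]; exact hu, hFu⟩

end BrouwerPart2

section MeasurePart

lemma hs_finite (d : ℕ) :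
    μH[(d : ℝ)] (Metric.sphere (0 : EuclideanSpace ℝ (Fin (d + 1))) 1) < ⊤ := by
  classical
  let ins : Fin (d+1) → Bool → (Fin d → ℝ) → EuclideanSpace ℝ (Fin (d+1)) := fun j s u =>
    WithLp.toLp 2 (Fin.insertNth (α := fun _ => ℝ) j (if s then (1:ℝ) else -1) u)
  have hins0 : ∀ j s u, ins j s u ≠ 0 := by
    intro j s u h
    have := congrArg (fun v => v j) h
    simp only [ins, Fin.insertNth_apply_same] at this
    cases s <;> simp at this
  have hinsC : ∀ j s, ContDiff ℝ 1 (ins j s) := by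
    intro j s
    rw [contDiff_euclidean]
    intro i
    refine Fin.succAboveCases j ?_ (fun k => ?_) i
    · simp only [ins, Fin.insertNth_apply_same]; exact contDiff_const
    · simp only [ins, Fin.insertNth_apply_succAbove]; exact contDiff_apply _ _ _
  let g : Fin (d+1) → Bool → (Fin d → ℝ) → EuclideanSpace ℝ (Fin (d+1)) := fun j s u =>
    ‖ins j s u‖⁻¹ • ins j s u
  have hg : ∀ j s, ContDiff ℝ 1 (g j s) := by
    intro j s
    exact (((hinsC j s).norm ℝ (hins0 j s)).inv (fun u => norm_ne_zero_iff.mpr (hins0 j s u))).smul (hinsC j s)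
  have hfin : ∀ j s, μH[(d : ℝ)] (g j s '' Metric.closedBall 0 1) < ⊤ := by
    intro j s
    obtain ⟨K, hK⟩ : ∃ K, LipschitzOnWith K (g j s) (Metric.closedBall 0 1) := by
      apply LocallyLipschitzOn.exists_lipschitzOnWith_of_compact (isCompact_closedBall _ _)
      intro x hx
      obtain ⟨K, t, ht, h⟩ := ((hg j s).contDiffAt (x := x)).exists_lipschitzOnWith
      exact ⟨K, t, mem_nhdsWithin_of_mem_nhds ht, h⟩
    refine (hK.hausdorffMeasure_image_le (Nat.cast_nonneg d)).trans_lt ?_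
    have : (μH[(d:ℝ)] : Measure (Fin d → ℝ)) = volume := by
      have := hausdorffMeasure_pi_real (ι := Fin d)
      simpa using this
    rw [this]
    refine ENNReal.mul_lt_top ?_ (isCompact_closedBall _ _).measure_lt_top
    exact ENNReal.rpow_lt_top_of_nonneg (Nat.cast_nonneg d) ENNReal.coe_ne_top
  have hsub : Metric.sphere (0 : EuclideanSpace ℝ (Fin (d + 1))) 1 ⊆
      ⋃ p : Fin (d+1) × Bool, g p.1 p.2 '' Metric.closedBall 0 1 := by
    intro y hy
    have hy1 : ‖y‖ = 1 := by simpa using hy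
    obtain ⟨j, -, hj⟩ := Finset.exists_max_image Finset.univ (fun i => |y i|) ⟨0, Finset.mem_univ _⟩
    have hj0 : 0 < |y j| := by
      by_contra hcon
      have h0 : |y j| = 0 := le_antisymm (not_lt.mp hcon) (abs_nonneg _)
      have : y = 0 := by
        ext i
        have := hj i (Finset.mem_univ _)
        rw [h0] at this
        simpa using le_antisymm this (abs_nonneg _)
      rw [this] at hy1; simp at hy1
    rw [Set.mem_iUnion]
    refine ⟨(j, decide (0 < y j)), fun i => y (j.succAbove i) / |y j|, ?_, ?_⟩
    · rw [mem_closedBall_zero_iff, pi_norm_le_iff_of_nonneg zero_le_one]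
      intro i
      rw [Real.norm_eq_abs, abs_div, abs_abs, div_le_one hj0]
      exact hj _ (Finset.mem_univ _)
    · have : ins j (decide (0 < y j)) (fun i => y (j.succAbove i) / |y j|) = |y j|⁻¹ • y := by
        ext i
        refine Fin.succAboveCases j ?_ (fun k => ?_) i
        · simp only [ins, Fin.insertNth_apply_same, PiLp.smul_apply, smul_eq_mul]
          by_cases h : 0 < y j
          · simp [h, abs_of_pos h, h.ne']
          · have h' : y j < 0 := lt_of_le_of_ne (not_lt.mp h) (by intro h0; simp [h0] at hj0)
            simp [h, abs_of_neg h', inv_neg, h'.ne]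
        · simp only [ins, Fin.insertNth_apply_succAbove, PiLp.smul_apply, smul_eq_mul]
          ring
      simp only [g]
      rw [this, norm_smul, hy1, smul_smul]
      simp [hj0.ne']
  refine (measure_mono hsub).trans_lt ?_
  refine (measure_iUnion_le _).trans_lt ?_
  rw [tsum_fintype]
  exact ENNReal.sum_lt_top.mpr fun p _ => hfin p.1 p.2

lemma hs_lower (d : ℕ) : ∃ c : ℝ, 0 < c ∧ ∀ x : EuclideanSpace ℝ (Fin (d + 1)), ‖x‖ = 1 →
    ∀ r : ℝ, 0 < r → r ≤ 1 → ENNReal.ofReal (c * r ^ d) ≤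
      μH[(d : ℝ)] (Metric.ball x r ∩ Metric.sphere (0 : EuclideanSpace ℝ (Fin (d + 1))) 1) := by
  refine ⟨(2 * (1 / (8 * ((d:ℝ)+1)^2))) ^ d, by positivity, ?_⟩
  intro x hx r hr hr1
  set ρ : ℝ := r / (8 * ((d:ℝ)+1)^2) with hρ
  have hd0 : (0:ℝ) ≤ d := Nat.cast_nonneg d
  have hρ0 : 0 < ρ := by positivity
  have hρr : 8 * ((d:ℝ)+1)^2 * ρ = r := by rw [hρ]; field_simp
  have hρ1 : ρ ≤ 1 := by nlinarith
  have hsum : ∑ i, x i ^ 2 = 1 := by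
    rw [← EuclideanSpace.real_norm_sq_eq, hx]; norm_num
  obtain ⟨j, hj⟩ : ∃ j, 1 / ((d:ℝ)+1) ≤ x j ^ 2 := by
    by_contra hcon
    push Not at hcon
    have := Finset.sum_lt_sum_of_nonempty (s := Finset.univ) ⟨0, Finset.mem_univ _⟩ (fun i _ => hcon i)
    rw [hsum] at this
    simp at this
    rw [mul_inv_cancel₀ (by positivity)] at this
    exact lt_irrefl _ this
  let π : EuclideanSpace ℝ (Fin (d+1)) → (Fin d → ℝ) := fun y i => y (j.succAbove i)
  have hπ : LipschitzWith 1 π := by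
    apply LipschitzWith.of_dist_le_mul
    intro y z
    rw [NNReal.coe_one, one_mul, dist_pi_le_iff dist_nonneg]
    intro i
    rw [dist_eq_norm y z, Real.dist_eq]
    exact PiLp.norm_apply_le (y - z) (j.succAbove i)
  have hle := hπ.hausdorffMeasure_image_le (Nat.cast_nonneg d) 
    (Metric.ball x r ∩ Metric.sphere (0 : EuclideanSpace ℝ (Fin (d + 1))) 1)
  have hH : (μH[(d:ℝ)] : Measure (Fin d → ℝ)) = volume := by
    have := hausdorffMeasure_pi_real (ι := Fin d)
    simpa using this
  simp only [ENNReal.coe_one, ENNReal.one_rpow, one_mul] at hle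
  refine le_trans ?_ hle
  rw [hH]
  have hsub : Metric.ball (π x) ρ ⊆ 
      π '' (Metric.ball x r ∩ Metric.sphere (0 : EuclideanSpace ℝ (Fin (d + 1))) 1) := by
    intro u hu
    rw [Metric.mem_ball, dist_pi_lt_iff hρ0] at hu
    have hu' : ∀ i, |u i - x (j.succAbove i)| < ρ := fun i => by
      have := hu i; rwa [Real.dist_eq] at this
    have hx1 : ∀ i, |x i| ≤ 1 := fun i => by
      have := PiLp.norm_apply_le x i; rwa [hx, Real.norm_eq_abs] at this
    have hsx : x j ^ 2 + ∑ i, x (j.succAbove i) ^ 2 = 1 := by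
      rw [← hsum, Fin.sum_univ_succAbove _ j]
    set B := x j ^ 2 with hB
    set A := 1 - ∑ i, u i ^ 2 with hA
    have hAB : |A - B| ≤ 3 * d * ρ := by
      have : A - B = ∑ i, (x (j.succAbove i) ^ 2 - u i ^ 2) := by
        rw [Finset.sum_sub_distrib]; linarith
      rw [this]
      refine (Finset.abs_sum_le_sum_abs _ _).trans ?_
      have : ∀ i ∈ Finset.univ, |x (j.succAbove i) ^ 2 - u i ^ 2| ≤ 3 * ρ := by
        intro i _
        have h1 := hu' i
        have h2 := hx1 (j.succAbove i)
        rw [show x (j.succAbove i) ^ 2 - u i ^ 2 = 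
          -((u i - x (j.succAbove i)) * (2 * x (j.succAbove i) + (u i - x (j.succAbove i)))) by ring,
          abs_neg, abs_mul]
        have h3 : |2 * x (j.succAbove i) + (u i - x (j.succAbove i))| ≤ 3 := by
          rw [abs_le] at *; rw [abs_lt] at h1
          constructor <;> linarith [h2.1, h2.2, h1.1, h1.2]
        calc _ ≤ ρ * 3 := mul_le_mul h1.le h3 (abs_nonneg _) hρ0.le
          _ = _ := by ring
      refine (Finset.sum_le_sum this).trans ?_
      simp; linarith
    have hB0 : 0 < B := lt_of_lt_of_le (by positivity) hj
    have h3 : 3 * d * ρ ≤ 1 / ((d:ℝ)+1) := by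
      rw [le_div_iff₀ (by positivity)]; nlinarith
    have hA0 : 0 ≤ A := by
      have := (abs_le.mp hAB).1; linarith
    have hsq : |Real.sqrt A - abs (x j)| ≤ 3 * d * (d+1) * ρ := by
      have hxj : Real.sqrt B = |x j| := by rw [hB, Real.sqrt_sq_eq_abs]
      have h4 : (Real.sqrt A - |x j|) * (Real.sqrt A + |x j|) = A - B := by
        have := Real.sq_sqrt hA0
        have h5 := sq_abs (x j)
        nlinarith
      have h5 : 1 / ((d:ℝ)+1) ≤ Real.sqrt A + |x j| := by
        have h6 : 1 / ((d:ℝ)+1) ≤ |x j| := by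
          have h7 : |x j| ^ 2 ≤ |x j| := by
            have := hx1 j; have := abs_nonneg (x j); nlinarith
          rw [sq_abs] at h7; linarith
        have := Real.sqrt_nonneg A; linarith
      have h6 : |Real.sqrt A - abs (x j)| * (Real.sqrt A + |x j|) ≤ 3 * d * ρ := by
        rw [← abs_of_nonneg (show 0 ≤ Real.sqrt A + |x j| by positivity), ← abs_mul, h4]; exact hAB
      have h7 : |Real.sqrt A - abs (x j)| * (1 / ((d:ℝ)+1)) ≤ 3 * d * ρ := 
        (mul_le_mul_of_nonneg_left h5 (abs_nonneg _)).trans h6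
      rw [mul_one_div, div_le_iff₀ (by positivity)] at h7
      linarith
    let s : ℝ := if 0 ≤ x j then 1 else -1
    have hs1 : s ^ 2 = 1 := by simp only [s]; split_ifs <;> norm_num
    have hs2 : |s * Real.sqrt A - x j| = |Real.sqrt A - abs (x j)| := by
      simp only [s]; split_ifs with h
      · rw [abs_of_nonneg h]; ring_nf
      · rw [abs_of_neg (not_le.mp h), ← abs_neg]; ring_nf
    let y : EuclideanSpace ℝ (Fin (d+1)) := WithLp.toLp 2 (Fin.insertNth (α := fun _ => ℝ) j (s * Real.sqrt A) u)
    have hyj : y j = s * Real.sqrt A := by simp [y]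
    have hyi : ∀ i, y (j.succAbove i) = u i := by intro i; simp [y]
    refine ⟨y, ⟨?_, ?_⟩, ?_⟩
    · rw [Metric.mem_ball, dist_eq_norm]
      have h9 : ‖y - x‖ ≤ 4 * ((d:ℝ)+1)^2 * ρ := by
        apply le_of_sq_le_sq _ (by positivity)
        rw [EuclideanSpace.real_norm_sq_eq, Fin.sum_univ_succAbove _ j]
        simp only [PiLp.sub_apply, hyj, hyi]
        have e1 : (s * Real.sqrt A - x j)^2 ≤ (3 * d * (d+1) * ρ)^2 := by
          rw [← sq_abs, hs2]; gcongr
        have e2 : ∑ i, (u i - x (j.succAbove i))^2 ≤ d * ρ^2 := by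
          have : ∀ i ∈ Finset.univ, (u i - x (j.succAbove i))^2 ≤ ρ^2 := fun i _ => by
            rw [← sq_abs]; gcongr; exact (hu' i).le
          refine (Finset.sum_le_sum this).trans ?_
          simp
        refine (add_le_add e1 e2).trans ?_
        have : (3 * (d:ℝ) * (d+1))^2 + d ≤ (4 * ((d:ℝ)+1)^2)^2 := by nlinarith [mul_nonneg hd0 hd0, mul_nonneg (mul_nonneg hd0 hd0) hd0]
        nlinarith [sq_nonneg ρ]
      refine h9.trans_lt ?_
      nlinarith
    · rw [mem_sphere_zero_iff_norm]
      have : ‖y‖ ^ 2 = 1 := by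
        rw [EuclideanSpace.real_norm_sq_eq, Fin.sum_univ_succAbove _ j]
        simp only [hyj, hyi]
        rw [mul_pow, hs1, Real.sq_sqrt hA0, hA]; ring
      have := norm_nonneg y
      nlinarith
    · funext i; exact hyi i
  refine le_trans ?_ (measure_mono hsub)
  rw [Real.volume_pi_ball _ hρ0]
  apply ENNReal.ofReal_le_ofReal
  rw [← mul_pow]
  simp only [Fintype.card_fin]
  rw [hρ]
  apply le_of_eq
  congr 1
  ring

instance sm_prob (d : ℕ) : IsProbabilityMeasure (sphereMeasure d) := by
  obtain ⟨c, hc, h⟩ := hs_lower d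
  constructor
  simp only [sphereMeasure, Measure.smul_apply, Measure.restrict_apply MeasurableSet.univ, Set.univ_inter, smul_eq_mul]
  apply ENNReal.inv_mul_cancel _ (hs_finite d).ne
  have h1 := h (EuclideanSpace.single 0 1) (by simp) 1 one_pos le_rfl
  intro h0
  have h2 := h1.trans (measure_mono Set.inter_subset_right)
  rw [h0] at h2
  simp at h2
  linarith

lemma sm_ae (d : ℕ) : ∀ᵐ y ∂(sphereMeasure d), ‖y‖ = 1 := by
  unfold sphereMeasure
  apply Measure.ae_smul_measure
  filter_upwards [ae_restrict_mem (Metric.isClosed_sphere (x := (0 : EuclideanSpace ℝ (Fin (d + 1)))) (ε := 1)).measurableSet] with y hy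
  simpa using hy

lemma sm_map (d : ℕ) (e : EuclideanSpace ℝ (Fin (d + 1)) ≃ₗᵢ[ℝ] EuclideanSpace ℝ (Fin (d + 1))) :
    MeasurePreserving e (sphereMeasure d) (sphereMeasure d) := by
  have h := (e.toIsometryEquiv.measurePreserving_hausdorffMeasure (d:ℝ))
  have h2 := h.restrict_preimage (s := Metric.sphere 0 1) Metric.isClosed_sphere.measurableSet
  have h3 : e.toIsometryEquiv ⁻¹' Metric.sphere 0 1 = Metric.sphere 0 1 := by
    ext y; simp
  rw [h3] at h2
  exact h2.smul_measure _

lemma sm_noatoms (d : ℕ) (hd : 0 < d) (x : EuclideanSpace ℝ (Fin (d + 1))) : sphereMeasure d {x} = 0 := by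
  have := Measure.nullSingletonClass_hausdorff (EuclideanSpace ℝ (Fin (d + 1))) (d := (d:ℝ)) (by exact_mod_cast hd)
  simp only [sphereMeasure, Measure.smul_apply, smul_eq_mul]
  rw [measure_singleton, mul_zero]

lemma sm_ball (d : ℕ) : ∃ c : ℝ, 0 < c ∧ ∀ x : EuclideanSpace ℝ (Fin (d + 1)), ‖x‖ = 1 →
    ∀ r : ℝ, 0 < r → r ≤ 1 → c * r ^ d ≤ (sphereMeasure d (Metric.ball x r)).toReal := by
  obtain ⟨c, hc, h⟩ := hs_lower d
  set m := μH[(d : ℝ)] (Metric.sphere (0 : EuclideanSpace ℝ (Fin (d + 1))) 1) with hm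
  have hmf : m ≠ ⊤ := (hs_finite d).ne
  have hm0 : m ≠ 0 := by
    intro h0
    have h1 := h (EuclideanSpace.single 0 1) (by simp) 1 one_pos le_rfl
    have h2 := h1.trans (measure_mono Set.inter_subset_right)
    rw [← hm, h0] at h2
    simp at h2
    linarith
  have hmr : 0 < m.toReal := ENNReal.toReal_pos hm0 hmf
  refine ⟨c / m.toReal, by positivity, fun x hx r hr hr1 => ?_⟩
  have h1 := h x hx r hr hr1
  simp only [sphereMeasure, Measure.smul_apply, smul_eq_mul]
  rw [Measure.restrict_apply Metric.isOpen_ball.measurableSet, ENNReal.toReal_mul, ENNReal.toReal_inv, ← hm]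
  have h2 : c * r ^ d ≤ (μH[(d : ℝ)] (Metric.ball x r ∩ Metric.sphere (0 : EuclideanSpace ℝ (Fin (d + 1))) 1)).toReal := by
    rw [← ENNReal.ofReal_le_iff_le_toReal]
    · exact h1
    · exact ne_top_of_le_ne_top hmf (measure_mono Set.inter_subset_right)
  rw [div_mul_eq_mul_div, div_eq_inv_mul]
  gcongr

end MeasurePart

section CombPart

lemma transport_comb {V : Type*} [Fintype V] [DecidableEq V] [Nonempty V] (adj : V → V → Prop)
    (hconn : ∀ A : Finset V, A.Nonempty → A ≠ Finset.univ → ∃ a ∈ A, ∃ b, b ∉ A ∧ adj b a)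
    (o : V → ℝ) (ho : ∀ v, 1 ≤ o v) (N : ℕ) (hN : ∑ v, o v = N) :
    ∃ (a : V → V → ℝ) (n : V → ℕ), (∀ u v, 0 ≤ a u v) ∧ (∀ u v, a u v ≠ 0 → u = v ∨ adj u v) ∧
      (∀ u, ∑ v, a u v = o u) ∧ (∀ v, ∑ u, a u v = n v) := by
  let P : Finset V → Prop := fun A => ∀ b : V → ℝ, (∀ v, 0 ≤ b v) → 
    (∃ m : ℤ, ∑ v ∈ A, (o v + b v) = m) → 
    ∃ (a : V → V → ℝ) (n : V → ℤ), (∀ u v, 0 ≤ a u v) ∧ (∀ u v, a u v ≠ 0 → u = v ∨ adj u v) ∧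
      (∀ u ∈ A, ∑ v ∈ A, a u v = o u) ∧ (∀ v ∈ A, b v + ∑ u ∈ A, a u v = n v)
  have base : ∀ v, P {v} := by
    intro v b hb ⟨m, hm⟩
    refine ⟨fun u w => if u = w then o u else 0, fun _ => m, ?_, ?_, ?_, ?_⟩
    · intro u w; dsimp only; split_ifs
      · linarith [ho u]
      · exact le_rfl
    · intro u w h; left; by_contra hne; simp [hne] at h
    · intro u hu; rw [Finset.mem_singleton] at hu; subst hu; simp
    · intro u hu; rw [Finset.mem_singleton] at hu; subst hu; simp at hm ⊢; linarith
  have step : ∀ A w a0, P A → w ∉ A → a0 ∈ A → adj w a0 → P (insert w A) := by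
    intro A w a0 hP hw ha0 hadj b hb ⟨m, hm⟩
    set r := Int.fract (o w + b w) with hr
    have hr0 : 0 ≤ r := Int.fract_nonneg _
    have hr1 : r < 1 := Int.fract_lt_one _
    have hfl : (⌊o w + b w⌋ : ℝ) = o w + b w - r := by rw [hr, Int.fract]; ring
    have hwa : ∀ v ∈ A, v ≠ w := fun v hv h => hw (h ▸ hv)
    obtain ⟨a', n', h1, h2, h3, h4⟩ := hP (fun v => b v + if v = a0 then r else 0) 
      (fun v => by split_ifs <;> linarith [hb v]) ⟨m - ⌊o w + b w⌋, by
        rw [Finset.sum_insert hw] at hm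
        push_cast
        rw [hfl]
        have : ∑ v ∈ A, (o v + (b v + if v = a0 then r else 0)) = ∑ v ∈ A, (o v + b v) + r := by
          simp_rw [← add_assoc]
          rw [Finset.sum_add_distrib]; simp [ha0]
        rw [this]; linarith⟩
    refine ⟨fun u v => if u = w then (if v = w then o w - r else if v = a0 then r else 0) else
      if v = w then 0 else a' u v, fun v => if v = w then ⌊o w + b w⌋ else n' v, ?_, ?_, ?_, ?_⟩
    · intro u v
      dsimp only
      split_ifs
      · linarith [ho w]
      · exact hr0
      · exact le_rfl
      · exact le_rfl
      · exact h1 u v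
    · intro u v h
      dsimp only at h
      split_ifs at h with e1 e2 e3 e4
      · left; rw [e1, e2]
      · right; rw [e1, e3]; exact hadj
      · exact absurd rfl h
      · exact absurd rfl h
      · exact h2 u v h
    · intro u hu
      rw [Finset.sum_insert hw]
      rcases Finset.mem_insert.mp hu with rfl | hu
      · simp only [if_true]
        rw [Finset.sum_congr rfl (g := fun v => if v = a0 then r else 0)
          (fun v hv => by simp [hwa v hv])]
        simp [ha0]
      · simp only [hwa u hu, if_false, if_true, zero_add]
        rw [← h3 u hu]
        exact Finset.sum_congr rfl (fun v hv => by simp [hwa v hv])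
    · intro v hv
      rw [Finset.sum_insert hw]
      rcases Finset.mem_insert.mp hv with rfl | hv
      · simp only [if_true]
        rw [Finset.sum_congr rfl (g := fun v => (0:ℝ)) (fun u hu => by simp [hwa u hu])]
        rw [hfl]; simp; ring
      · simp only [hwa v hv, if_false, if_true]
        rw [← h4 v hv]
        rw [Finset.sum_congr rfl (g := fun u => a' u v) (fun u hu => by simp [hwa u hu])]
        ring
  obtain ⟨A, hA⟩ : ∃ A, Maximal (fun A : Finset V => A.Nonempty ∧ P A) A := by
    have hfin : {A : Finset V | A.Nonempty ∧ P A}.Finite := Set.toFinite _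
    exact hfin.exists_maximal ⟨{Classical.arbitrary V}, by simp, base _⟩
  have hAu : A = Finset.univ := by
    by_contra hne
    obtain ⟨a, ha, b, hb, hab⟩ := hconn A hA.prop.1 hne
    have h1 := hA.le_of_ge (y := insert b A) ⟨by simp, step A b a hA.prop.2 hb ha hab⟩ (Finset.subset_insert _ _)
    exact hb (h1 (Finset.mem_insert_self _ _))
  obtain ⟨a, n, h1, h2, h3, h4⟩ := (hAu ▸ hA.prop.2) (fun _ => 0) (fun _ => le_rfl) ⟨N, by simpa using hN⟩
  refine ⟨a, fun v => (n v).toNat, h1, h2, fun u => h3 u (Finset.mem_univ _), fun v => ?_⟩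
  have h5 := h4 v (Finset.mem_univ _)
  rw [zero_add] at h5
  have h6 : 0 ≤ n v := by
    have : (0:ℝ) ≤ n v := by rw [← h5]; exact Finset.sum_nonneg fun u _ => h1 u v
    exact_mod_cast this
  rw [h5]
  have := Int.toNat_of_nonneg h6
  exact_mod_cast this.symm

end CombPart

section PartitionPart

lemma partition_lemma (d : ℕ) (hd : 2 ≤ d) : ∃ c : ℝ, 0 < c ∧ ∀ δ : ℝ, 0 < δ → δ ≤ 1 → ∀ N : ℕ,
    c * (δ⁻¹) ^ d ≤ N → ∃ x : Fin N → EuclideanSpace ℝ (Fin (d + 1)), Function.Injective x ∧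
      (∀ i, ‖x i‖ = 1) ∧ ∀ f : EuclideanSpace ℝ (Fin (d + 1)) → ℝ, Continuous f → ∀ G : Fin N → ℝ,
        (∀ i y, ‖y‖ = 1 → ‖y - x i‖ ≤ δ → f y ≤ G i) →
          N * ∫ y, f y ∂(sphereMeasure d) ≤ ∑ i, G i := by
  classical
  obtain ⟨c0, hc0, hball⟩ := sm_ball d
  refine ⟨c0⁻¹ * 10 ^ d, by positivity, fun δ hδ hδ1 N hN => ?_⟩
  set r := δ / 10 with hr
  have hr0 : 0 < r := by positivity
  have hr1 : r ≤ 1 := by rw [hr]; linarith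
  have hNr : 1 ≤ N * (c0 * r ^ d) := by
    have h1 : c0⁻¹ * 10 ^ d * (δ⁻¹) ^ d * (c0 * r ^ d) = 1 := by
      rw [hr, div_pow, inv_pow]; field_simp
    rw [← h1]; gcongr
  have hNpos : 0 < (N:ℝ) := by
    by_contra h
    have : (N:ℝ) = 0 := le_antisymm (not_lt.mp h) (Nat.cast_nonneg _)
    rw [this] at hNr; norm_num at hNr
  set S := Metric.sphere (0 : EuclideanSpace ℝ (Fin (d + 1))) 1 with hS
  -- net
  obtain ⟨Z, hZS, hZsep, hZcov⟩ : ∃ Z : Finset (EuclideanSpace ℝ (Fin (d + 1))), (∀ z ∈ Z, ‖z‖ = 1) ∧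
      (∀ z ∈ Z, ∀ w ∈ Z, z ≠ w → 2 * r ≤ dist z w) ∧ (∀ y, ‖y‖ = 1 → ∃ z ∈ Z, dist y z ≤ 3 * r) := by
    obtain ⟨t, htS, htf, htc⟩ := (isCompact_sphere (0 : EuclideanSpace ℝ (Fin (d + 1))) 1).finite_cover_balls hr0
    obtain ⟨Z, hZ⟩ := ((htf.toFinset.powerset.finite_toSet).subset
      (fun Z (hZ : Z ∈ {Z : Finset (EuclideanSpace ℝ (Fin (d + 1))) | Z ⊆ htf.toFinset ∧ ∀ z ∈ Z, ∀ w ∈ Z, z ≠ w → 2 * r ≤ dist z w}) => by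
        simpa using hZ.1)).exists_maximal ⟨∅, by simp⟩
    refine ⟨Z, fun z hz => ?_, hZ.prop.2, fun y hy => ?_⟩
    · have := hZ.prop.1 hz
      simpa using htS (by simpa using this)
    · obtain ⟨x, hx, hyx⟩ : ∃ x ∈ t, dist y x < r := by
        have := htc (show y ∈ Metric.sphere _ _ by simpa using hy)
        simpa using this
      by_contra hcon
      push Not at hcon
      have hfar : ∀ z ∈ Z, 2 * r < dist x z := fun z hz => by
        have h1 := hcon z hz
        have h2 := dist_triangle y x z
        linarith
      have hxZ : x ∉ Z := fun h => by
        have := hfar x h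
        simp at this; linarith
      have h1 := hZ.le_of_ge (y := insert x Z) ⟨?_, ?_⟩ (Finset.subset_insert _ _)
      · exact hxZ (h1 (Finset.mem_insert_self _ _))
      · exact Finset.insert_subset (by simpa using hx) hZ.prop.1
      · intro z hz w hw hzw
        rcases Finset.mem_insert.mp hz with h1 | h1 <;> rcases Finset.mem_insert.mp hw with h2 | h2
        · exact absurd (h1.trans h2.symm) hzw
        · rw [h1]; exact (hfar w h2).le
        · rw [h2, dist_comm]; exact (hfar z h1).le
        · exact hZ.prop.2 z h1 w h2 hzw
  let m := Z.card
  let z : Fin m → EuclideanSpace ℝ (Fin (d + 1)) := fun v => (Z.equivFin.symm v : EuclideanSpace ℝ (Fin (d + 1)))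
  have hz1 : ∀ v, ‖z v‖ = 1 := fun v => hZS _ (Z.equivFin.symm v).2
  have hzsep : ∀ u v, u ≠ v → 2 * r ≤ dist (z u) (z v) := fun u v huv =>
    hZsep _ (Z.equivFin.symm u).2 _ (Z.equivFin.symm v).2 (fun h => huv (by
      simpa using Subtype.ext h))
  have hzcov : ∀ y, ‖y‖ = 1 → ∃ v, dist y (z v) ≤ 3 * r := fun y hy => by
    obtain ⟨w, hw, h⟩ := hZcov y hy
    exact ⟨Z.equivFin ⟨w, hw⟩, by simpa [z] using h⟩
  have : Nonempty (Fin m) := by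
    obtain ⟨v, -⟩ := hzcov (EuclideanSpace.single 0 1) (by simp)
    exact ⟨v⟩
  clear_value z m
  -- cells
  let W : Fin m → Set (EuclideanSpace ℝ (Fin (d + 1))) := fun v => {y | ∀ u, dist y (z v) ≤ dist y (z u)}
  have hWc : ∀ v, MeasurableSet (W v) := fun v => by
    have : W v = ⋂ u, {y | dist y (z v) ≤ dist y (z u)} := by ext y; simp [W]
    rw [this]
    exact MeasurableSet.iInter fun u => (isClosed_le (by fun_prop) (by fun_prop)).measurableSet
  let cell : Fin m → Set (EuclideanSpace ℝ (Fin (d + 1))) := fun v => W v \ ⋃ u, ⋃ (_ : u < v), W u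
  have hcm : ∀ v, MeasurableSet (cell v) := fun v =>
    (hWc v).diff (MeasurableSet.iUnion fun u => MeasurableSet.iUnion fun _ => hWc u)
  have hcdisj : Pairwise (Function.onFun Disjoint cell) := by
    have key : ∀ u v, u < v → Disjoint (cell u) (cell v) := by
      intro u v huv
      rw [Set.disjoint_left]
      intro y hy1 hy2
      apply hy2.2
      simp only [Set.mem_iUnion]
      exact ⟨u, huv, hy1.1⟩
    intro u v huv
    rcases lt_or_gt_of_ne huv with h | h
    · exact key u v h
    · exact (key v u h).symm
  have hcun : ⋃ v, cell v = Set.univ := by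
    rw [Set.eq_univ_iff_forall]
    intro y
    obtain ⟨v0, -, hv0⟩ := Finset.exists_min_image Finset.univ (fun v => dist y (z v)) Finset.univ_nonempty
    have hne : (Finset.univ.filter fun v => y ∈ W v).Nonempty := 
      ⟨v0, by simp only [Finset.mem_filter, Finset.mem_univ, true_and]; exact fun u => hv0 u (Finset.mem_univ _)⟩
    refine Set.mem_iUnion.mpr ⟨Finset.min' _ hne, ?_, ?_⟩
    · have := Finset.min'_mem _ hne
      simpa using this
    · intro h
      simp only [Set.mem_iUnion] at h
      obtain ⟨u, hu, hyu⟩ := h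
      have := Finset.min'_le (Finset.univ.filter fun v => y ∈ W v) u (by simpa using hyu)
      exact absurd hu (not_lt.mpr this)
  have hcball : ∀ v, Metric.ball (z v) r ⊆ cell v := by
    intro v y hy
    have hy' : dist y (z v) < r := hy
    have hst : ∀ u, u ≠ v → dist y (z v) < dist y (z u) := fun u hu => by
      have h1 := hzsep u v hu
      have h2 := dist_triangle_left (z u) (z v) y
      linarith
    refine ⟨fun u => ?_, ?_⟩
    · by_cases h : u = v
      · rw [h]
      · exact (hst u h).le
    · intro h
      simp only [Set.mem_iUnion] at h
      obtain ⟨u, hu, hyu⟩ := h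
      exact absurd (hyu v) (not_le.mpr (hst u hu.ne))
  have hcclose : ∀ v y, ‖y‖ = 1 → y ∈ cell v → dist y (z v) ≤ 3 * r := by
    intro v y hy hyc
    obtain ⟨u, hu⟩ := hzcov y hy
    exact (hyc.1 u).trans hu
  let μ := sphereMeasure d
  let o : Fin m → ℝ := fun v => N * μ.real (cell v)
  have ho : ∀ v, 1 ≤ o v := by
    intro v
    refine hNr.trans ?_
    have h1 := hball (z v) (hz1 v) r hr0 hr1
    have h2 : (μ (Metric.ball (z v) r)).toReal ≤ μ.real (cell v) := measureReal_mono (hcball v)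
    exact mul_le_mul_of_nonneg_left (h1.trans h2) hNpos.le
  have hoN : ∑ v, o v = N := by
    simp only [o]
    rw [← Finset.mul_sum]
    have h1 : μ.real (⋃ v, cell v) = ∑ v, μ.real (cell v) := measureReal_iUnion_fintype hcdisj hcm
    rw [← h1, hcun]
    simp [μ]
  obtain ⟨a, n, ha0, hasupp, harow, hacol⟩ := transport_comb (fun u v => dist (z u) (z v) ≤ 6 * r) (by
    intro A hA hAu
    by_contra hcon
    push Not at hcon
    have hconnS : IsPreconnected S := isPreconnected_sphere (by
      rw [← Module.finrank_eq_rank]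
      simp; omega) _ _
    rw [isPreconnected_closed_iff] at hconnS
    obtain ⟨v1, hv1⟩ := hA
    obtain ⟨v2, hv2⟩ : ∃ v, v ∉ A := by
      by_contra h; push Not at h; exact hAu (Finset.eq_univ_iff_forall.mpr h)
    obtain ⟨y, hyS, hy1, hy2⟩ := hconnS (⋃ v ∈ A, Metric.closedBall (z v) (3*r)) (⋃ v ∈ Aᶜ, Metric.closedBall (z v) (3*r))
      (A.finite_toSet.isClosed_biUnion fun v _ => Metric.isClosed_closedBall) 
      (Aᶜ.finite_toSet.isClosed_biUnion fun v _ => Metric.isClosed_closedBall)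
      (by
        intro y hy
        obtain ⟨v, hv⟩ := hzcov y (by simpa [hS] using hy)
        by_cases h : v ∈ A
        · left; simp only [Set.mem_iUnion]; exact ⟨v, h, hv⟩
        · right; simp only [Set.mem_iUnion]; exact ⟨v, by simpa using h, hv⟩)
      ⟨z v1, by simpa [hS] using hz1 v1, by 
        simp only [Set.mem_iUnion]; exact ⟨v1, hv1, by simp; positivity⟩⟩
      ⟨z v2, by simpa [hS] using hz1 v2, by 
        simp only [Set.mem_iUnion]; exact ⟨v2, by simpa using hv2, by simp; positivity⟩⟩
    simp only [Set.mem_iUnion] at hy1 hy2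
    obtain ⟨u, hu, hyu⟩ := hy1
    obtain ⟨w, hw, hyw⟩ := hy2
    have h1 := hcon u hu w (by simpa using hw)
    have h2 := dist_triangle_left (z w) (z u) y
    rw [Metric.mem_closedBall] at hyu hyw
    linarith) o ho N hoN
  have hcard : Fintype.card (Σ v, Fin (n v)) = N := by
    have : (Fintype.card (Σ v, Fin (n v)) : ℝ) = N := by
      rw [← hoN]
      simp only [Fintype.card_sigma, Fintype.card_fin, Nat.cast_sum]
      simp_rw [← hacol, ← harow]
      exact Finset.sum_comm
    exact_mod_cast this
  have hinf : ∀ v, (Metric.ball (z v) r ∩ S).Infinite := by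
    intro v hfin
    have h1 : μ (Metric.ball (z v) r ∩ S) = 0 := by
      rw [← Set.biUnion_of_singleton (Metric.ball (z v) r ∩ S)]
      rw [measure_biUnion_null_iff hfin.countable]
      intro x _
      exact sm_noatoms d (by omega) x
    have h2 : μ (Metric.ball (z v) r) = 0 := by
      rw [← h1]
      apply measure_congr
      filter_upwards [sm_ae d] with y hy
      apply propext
      constructor
      · intro h; exact ⟨h, by simpa [hS] using hy⟩
      · intro h; exact h.1
    have h3 := hball (z v) (hz1 v) r hr0 hr1
    change _ ≤ (μ _).toReal at h3
    rw [h2] at h3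
    have : 0 < c0 * r ^ d := by positivity
    simp at h3
    linarith
  let e : Fin N ≃ Σ v, Fin (n v) := (finCongr hcard.symm).trans (Fintype.equivFin _).symm
  let X : (Σ v, Fin (n v)) → EuclideanSpace ℝ (Fin (d + 1)) := fun i => ((hinf i.1).natEmbedding _ i.2 : _)
  have hX : ∀ i, X i ∈ Metric.ball (z i.1) r ∩ S := fun i => ((hinf i.1).natEmbedding _ i.2).2
  have hXinj : Function.Injective X := by
    rintro ⟨u, i⟩ ⟨v, j⟩ h
    have huv : u = v := by
      by_contra hne
      have h1 := hzsep u v hne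
      have h2 := (hX ⟨u, i⟩).1
      have h3 := (hX ⟨v, j⟩).1
      rw [h] at h2
      rw [Metric.mem_ball] at h2 h3
      have h4 := dist_triangle_left (z u) (z v) (X ⟨v, j⟩)
      dsimp only at h2 h3
      linarith
    subst huv
    have := (hinf u).natEmbedding _ |>.injective (Subtype.ext h)
    simp at this
    rw [Fin.ext this]
  refine ⟨fun i => X (e i), hXinj.comp e.injective, fun i => by simpa [hS] using (hX (e i)).2, ?_⟩
  intro f hf G hG
  have hfint : Integrable f μ := by
    obtain ⟨C, hC⟩ := (isCompact_sphere (0 : EuclideanSpace ℝ (Fin (d + 1))) 1).exists_bound_of_continuousOn hf.continuousOn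
    refine Integrable.of_bound hf.aestronglyMeasurable C ?_
    filter_upwards [sm_ae d] with y hy
    exact hC y (by simpa using hy)
  have hsplit : ∫ y, f y ∂μ = ∑ u, ∫ y in cell u, f y ∂μ := by
    rw [← integral_iUnion_fintype hcm hcdisj (fun u => hfint.integrableOn), hcun, Measure.restrict_univ]
  let G' : (Σ v, Fin (n v)) → ℝ := fun i => G (e.symm i)
  have hGsum : ∑ i, G i = ∑ v, ∑ k, G' ⟨v, k⟩ := by
    rw [← Fintype.sum_sigma']
    exact (Equiv.sum_comp e.symm G).symm
  have hmain : ∀ v k, ∑ u, a u v * (N / o u * ∫ y in cell u, f y ∂μ) ≤ n v * G' ⟨v, k⟩ := by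
    intro v k
    rw [← hacol v, Finset.sum_mul]
    apply Finset.sum_le_sum
    intro u _
    by_cases hau : a u v = 0
    · simp [hau]
    · apply mul_le_mul_of_nonneg_left _ (ha0 u v)
      have hou : 0 < o u := lt_of_lt_of_le one_pos (ho u)
      have h1 : ∫ y in cell u, f y ∂μ ≤ ∫ y in cell u, G' ⟨v, k⟩ ∂μ := by
        apply setIntegral_mono_on_ae hfint.integrableOn (integrable_const _) (hcm u)
        filter_upwards [sm_ae d] with y hy hyu
        refine hG _ y hy ?_
        rw [← dist_eq_norm]
        simp only [Equiv.apply_symm_apply]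
        have h2 := hcclose u y hy hyu
        have h3 : dist (z u) (z v) ≤ 6 * r := by
          rcases hasupp u v hau with rfl | h
          · simp; positivity
          · exact h
        have h4 := (hX ⟨v, k⟩).1
        rw [Metric.mem_ball, dist_comm] at h4
        have h5 := dist_triangle4 y (z u) (z v) (X ⟨v, k⟩)
        dsimp only at h4
        rw [hr] at *
        linarith
      rw [setIntegral_const, smul_eq_mul] at h1
      rw [div_mul_eq_mul_div, div_le_iff₀ hou]
      calc N * ∫ y in cell u, f y ∂μ ≤ N * (μ.real (cell u) * G' ⟨v, k⟩) := by gcongr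
        _ = _ := by simp only [o]; ring
  have hmain2 : ∀ v, ∑ u, a u v * (N / o u * ∫ y in cell u, f y ∂μ) ≤ ∑ k, G' ⟨v, k⟩ := by
    intro v
    by_cases hn : n v = 0
    · have h0 : ∀ u, a u v = 0 := by
        have h1 := hacol v
        rw [hn, Nat.cast_zero, Finset.sum_eq_zero_iff_of_nonneg (fun u _ => ha0 u v)] at h1
        exact fun u => h1 u (Finset.mem_univ _)
      have : IsEmpty (Fin (n v)) := by rw [hn]; infer_instance
      simp [h0]
    · have hnp : (0:ℝ) < n v := by exact_mod_cast Nat.pos_of_ne_zero hn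
      have h1 := Finset.sum_le_sum (s := Finset.univ) (fun k _ => hmain v k)
      rw [← Finset.mul_sum] at h1
      simp only [Finset.sum_const, Finset.card_univ, Fintype.card_fin, nsmul_eq_mul] at h1
      exact le_of_mul_le_mul_left h1 hnp
  rw [hGsum]
  refine le_trans (le_of_eq ?_) (Finset.sum_le_sum fun v _ => hmain2 v)
  rw [Finset.sum_comm]
  simp_rw [← Finset.sum_mul]
  simp_rw [harow]
  change N * ∫ y, f y ∂μ = _
  rw [hsplit, Finset.mul_sum]
  refine Finset.sum_congr rfl fun u _ => ?_
  have hou : 0 < o u := lt_of_lt_of_le one_pos (ho u)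
  field_simp

end PartitionPart

section BernsteinPart

/-- the complex exponential of integer frequency -/
noncomputable def ce (k : ℤ) (s : ℝ) : ℂ := Complex.exp (Complex.I * k * s)

lemma ce_mul (k l : ℤ) (s : ℝ) : ce k s * ce l s = ce (k + l) s := by
  simp only [ce, ← Complex.exp_add]; congr 1; push_cast; ring

lemma ce_conj (k : ℤ) (s : ℝ) : (starRingEnd ℂ) (ce k s) = ce (-k) s := by
  simp only [ce, ← Complex.exp_conj]; congr 1
  simp

lemma ce_avg (M : ℕ) (hM : 0 < M) (l : ℤ) (hl : |l| < M) :
    (M : ℂ)⁻¹ * ∑ j ∈ Finset.range M, ce l (2 * Real.pi * j / M) = if l = 0 then 1 else 0 := by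
  have hM0 : (M : ℂ) ≠ 0 := by exact_mod_cast hM.ne'
  split_ifs with h
  · subst h
    simp [ce, hM0]
  · set z : ℂ := Complex.exp (Complex.I * l * (2 * Real.pi / M)) with hz
    have h1 : ∀ j : ℕ, ce l (2 * Real.pi * j / M) = z ^ j := by
      intro j
      rw [hz, ← Complex.exp_nat_mul, ce]; congr 1; push_cast; ring
    have hzM : z ^ M = 1 := by
      rw [hz, ← Complex.exp_nat_mul, Complex.exp_eq_one_iff]
      refine ⟨l, ?_⟩
      field_simp
    have hz1 : z ≠ 1 := by
      intro h1
      rw [hz, Complex.exp_eq_one_iff] at h1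
      obtain ⟨n, hn⟩ := h1
      have hpi : (Real.pi : ℂ) ≠ 0 := by exact_mod_cast Real.pi_ne_zero
      have h2 : (l : ℂ) = n * M := by
        field_simp at hn
        have h3 : (2 * Complex.I * Real.pi : ℂ) ≠ 0 := by simp [hpi]
        apply mul_left_cancel₀ h3
        linear_combination (2 * Complex.I * Real.pi : ℂ) * hn
      have h3 : l = n * M := by exact_mod_cast h2
      have hn0 : n ≠ 0 := by rintro rfl; simp at h3; exact h h3
      have : (1:ℤ) ≤ |n| := Int.one_le_abs hn0
      rw [h3, abs_mul, Nat.abs_cast] at hl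
      have : (0:ℤ) < M := by exact_mod_cast hM
      nlinarith
    rw [Finset.sum_congr rfl (fun j _ => h1 j), geom_sum_eq hz1, hzM]
    simp

lemma bern_count (m : ℕ) (k : ℤ) (hk : |k| ≤ m) :
    ∑ a ∈ Finset.range m, ∑ b ∈ Finset.range m, ((if (m:ℤ) + k + a - b = 0 then (1:ℂ) else 0) -
      if -(m:ℤ) + k + a - b = 0 then (1:ℂ) else 0) = -k := by
  have hk' := abs_le.mp hk
  have h1 : ∀ a ∈ Finset.range m, ∑ b ∈ Finset.range m, ((if (m:ℤ) + k + a - b = 0 then (1:ℂ) else 0) -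
      if -(m:ℤ) + k + a - b = 0 then (1:ℂ) else 0) = (if (a:ℤ) + k < 0 then 1 else 0) - (if (m:ℤ) ≤ a + k then 1 else 0) := by
    intro a ha
    rw [Finset.mem_range] at ha
    rw [Finset.sum_sub_distrib]
    congr 1
    · split_ifs with h
      · rw [Finset.sum_eq_single ((m:ℤ) + k + a).toNat]
        · rw [if_pos]; omega
        · intro b _ hb; rw [if_neg]; omega
        · intro hb; exact absurd (Finset.mem_range.mpr (by omega)) hb
      · apply Finset.sum_eq_zero
        intro b hb; rw [Finset.mem_range] at hb; rw [if_neg]; omega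
    · split_ifs with h
      · rw [Finset.sum_eq_single (-(m:ℤ) + k + a).toNat]
        · rw [if_pos]; omega
        · intro b _ hb; rw [if_neg]; omega
        · intro hb; exact absurd (Finset.mem_range.mpr (by omega)) hb
      · apply Finset.sum_eq_zero
        intro b hb; rw [Finset.mem_range] at hb; rw [if_neg]; omega
  rw [Finset.sum_congr rfl h1, Finset.sum_sub_distrib, Finset.sum_boole, Finset.sum_boole]
  have e1 : (Finset.range m).filter (fun a : ℕ => (a:ℤ) + k < 0) = Finset.range (-k).toNat := by
    ext a; simp only [Finset.mem_filter, Finset.mem_range]; omega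
  have e2 : (Finset.range m).filter (fun a : ℕ => (m:ℤ) ≤ a + k) = Finset.Ico (m - k.toNat) m := by
    ext a; simp only [Finset.mem_filter, Finset.mem_range, Finset.mem_Ico]; omega
  rw [e1, e2, Finset.card_range, Nat.card_Ico]
  have : ((((-k).toNat : ℤ) - ((m - (m - k.toNat) : ℕ) : ℤ) : ℤ) : ℂ) = ((-k : ℤ) : ℂ) := by
    congr 1; omega
  push_cast at this ⊢
  exact this

lemma bern_weights (m : ℕ) (hm : 0 < m) : ∃ (M : ℕ) (s w : ℕ → ℝ),
    ∑ j ∈ Finset.range M, |w j| ≤ 2 * m ∧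
    ∀ k : ℤ, |k| ≤ m → ∑ j ∈ Finset.range M, (w j : ℂ) * ce k (s j) = Complex.I * k := by
  let M := 3 * m
  have hM : 0 < M := by omega
  let s : ℕ → ℝ := fun j => 2 * Real.pi * j / M
  let Dk : ℝ → ℂ := fun s => ∑ a ∈ Finset.range m, ce a s
  let w : ℕ → ℝ := fun j => (M:ℝ)⁻¹ * (2 * Real.sin (m * s j) * Complex.normSq (Dk (s j)))
  have hnq : ∀ s, ((Complex.normSq (Dk s) : ℝ) : ℂ) = ∑ a ∈ Finset.range m, ∑ b ∈ Finset.range m, ce ((a:ℤ) - b) s := by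
    intro s
    rw [← Complex.mul_conj]
    simp only [Dk, map_sum, ce_conj, Finset.sum_mul_sum, ce_mul]
    rfl
  have hsin : ∀ s : ℝ, ((2 * Real.sin (m * s) : ℝ) : ℂ) = -Complex.I * (ce m s - ce (-m) s) := by
    intro s
    simp only [ce]
    push_cast
    rw [Complex.sin]
    have e1 : Complex.I * (m:ℂ) * (s:ℂ) = (m:ℂ) * s * Complex.I := by ring
    have e2 : Complex.I * (-(m:ℂ)) * (s:ℂ) = -((m:ℂ) * s) * Complex.I := by ring
    rw [e1, e2]
    ring
  refine ⟨M, s, w, ?_, ?_⟩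
  · have h1 : ∀ j ∈ Finset.range M, |w j| ≤ (M:ℝ)⁻¹ * (2 * Complex.normSq (Dk (s j))) := by
      intro j _
      simp only [w]
      rw [abs_mul, abs_mul, abs_mul, abs_of_nonneg (by positivity : (0:ℝ) ≤ (M:ℝ)⁻¹), abs_of_nonneg (Complex.normSq_nonneg _)]
      gcongr
      · exact Complex.normSq_nonneg _
      · have := Real.abs_sin_le_one (m * s j)
        rw [abs_of_pos (by norm_num : (0:ℝ) < 2)]; linarith
    refine (Finset.sum_le_sum h1).trans ?_
    rw [← Finset.mul_sum, ← Finset.mul_sum]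
    have h2 : (((M:ℝ)⁻¹ * ∑ j ∈ Finset.range M, Complex.normSq (Dk (s j)) : ℝ) : ℂ) = ((m : ℝ) : ℂ) := by
      push_cast
      simp_rw [hnq]
      rw [Finset.sum_comm, Finset.mul_sum]
      rw [Finset.sum_congr rfl (g := fun a => (1:ℂ))]
      · simp
      · intro a ha
        rw [Finset.mem_range] at ha
        rw [Finset.sum_comm, Finset.mul_sum]
        rw [Finset.sum_congr rfl (g := fun b : ℕ => if (a:ℤ) - b = 0 then (1:ℂ) else 0)]
        · rw [Finset.sum_eq_single a]
          · simp
          · intro b _ hb; rw [if_neg]; omega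
          · intro h; exact absurd (Finset.mem_range.mpr ha) h
        · intro b hb
          rw [Finset.mem_range] at hb
          exact ce_avg M hM _ (by rw [abs_lt]; constructor <;> simp only [M] <;> push_cast <;> omega)
    have h3 : (M:ℝ)⁻¹ * ∑ j ∈ Finset.range M, Complex.normSq (Dk (s j)) = m := by exact_mod_cast h2
    linarith
  · intro k hk
    have hk' := abs_le.mp hk
    have h1 : ∀ j ∈ Finset.range M, (w j : ℂ) * ce k (s j) = -Complex.I * ((M:ℂ)⁻¹ * 
        ∑ a ∈ Finset.range m, ∑ b ∈ Finset.range m, 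
          (ce ((m:ℤ) + k + a - b) (s j) - ce (-(m:ℤ) + k + a - b) (s j))) := by
      intro j _
      simp only [w]
      rw [Complex.ofReal_mul, Complex.ofReal_mul, hnq, hsin]
      have : ∀ a b : ℕ, (ce ((m:ℤ) + k + a - b) (s j) - ce (-(m:ℤ) + k + a - b) (s j)) = 
          (ce m (s j) - ce (-m) (s j)) * ce k (s j) * ce ((a:ℤ) - b) (s j) := by
        intro a b
        rw [sub_mul, sub_mul, ce_mul, ce_mul, ce_mul, ce_mul]
        congr 2 <;> ring
      simp_rw [this, ← Finset.mul_sum]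
      push_cast
      ring
    rw [Finset.sum_congr rfl h1, ← Finset.mul_sum, ← Finset.mul_sum, Finset.sum_comm, Finset.mul_sum]
    have h2 : ∀ a ∈ Finset.range m, (M:ℂ)⁻¹ * ∑ j ∈ Finset.range M, ∑ b ∈ Finset.range m, 
          (ce ((m:ℤ) + k + a - b) (s j) - ce (-(m:ℤ) + k + a - b) (s j)) = 
        ∑ b ∈ Finset.range m, ((if (m:ℤ) + k + a - b = 0 then (1:ℂ) else 0) -
          if -(m:ℤ) + k + a - b = 0 then (1:ℂ) else 0) := by
      intro a ha
      rw [Finset.mem_range] at ha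
      rw [Finset.sum_comm, Finset.mul_sum]
      refine Finset.sum_congr rfl fun b hb => ?_
      rw [Finset.mem_range] at hb
      rw [Finset.sum_sub_distrib, mul_sub]
      rw [ce_avg M hM _ (by rw [abs_lt]; constructor <;> simp only [M] <;> push_cast <;> omega)]
      rw [ce_avg M hM _ (by rw [abs_lt]; constructor <;> simp only [M] <;> push_cast <;> omega)]
    rw [Finset.sum_congr rfl h2, bern_count m k hk]
    ring

/-- trigonometric polynomials of degree at most `m` -/
noncomputable def trigP (m : ℕ) : Submodule ℂ (ℝ → ℂ) :=
  Submodule.span ℂ {f | ∃ k : ℤ, |k| ≤ m ∧ f = ce k}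

lemma trigP_mul {m n : ℕ} {f g : ℝ → ℂ} (hf : f ∈ trigP m) (hg : g ∈ trigP n) : f * g ∈ trigP (m + n) := by
  have h1 := Submodule.mul_mem_mul hf hg
  rw [trigP, trigP, Submodule.span_mul_span] at h1
  refine Submodule.span_mono ?_ h1
  rintro _ ⟨_, ⟨k, hk, rfl⟩, _, ⟨l, hl, rfl⟩, rfl⟩
  refine ⟨k + l, ?_, funext fun s => ce_mul k l s⟩
  push_cast
  exact (abs_add_le _ _).trans (add_le_add hk hl)

lemma trigP_mono {m n : ℕ} (h : m ≤ n) : trigP m ≤ trigP n := by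
  refine Submodule.span_mono ?_
  rintro _ ⟨k, hk, rfl⟩
  exact ⟨k, hk.trans (by exact_mod_cast h), rfl⟩

lemma trigP_one (m : ℕ) : (1 : ℝ → ℂ) ∈ trigP m := by
  refine Submodule.subset_span ⟨0, by simp, ?_⟩
  funext s; simp [ce]

lemma trigP_const (m : ℕ) (c : ℂ) : (fun _ => c : ℝ → ℂ) ∈ trigP m := by
  have := (trigP m).smul_mem c (trigP_one m)
  convert this using 1
  funext s; simp

lemma trigP_pow {m : ℕ} {f : ℝ → ℂ} (hf : f ∈ trigP m) (n : ℕ) : f ^ n ∈ trigP (n * m) := by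
  induction n with
  | zero => simpa using trigP_one _
  | succ n ih => 
    rw [pow_succ, Nat.succ_mul]; exact trigP_mul ih hf

lemma trigP_prod {ι : Type*} (A : Finset ι) (f : ι → ℝ → ℂ) (n : ι → ℕ) (h : ∀ i ∈ A, f i ∈ trigP (n i)) :
    ∏ i ∈ A, f i ∈ trigP (∑ i ∈ A, n i) := by
  classical
  induction A using Finset.induction_on with
  | empty => simpa using trigP_one _
  | insert a A ha ih =>
    rw [Finset.prod_insert ha, Finset.sum_insert ha]
    exact trigP_mul (h a (by simp)) (ih fun i hi => h i (Finset.mem_insert_of_mem hi))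

lemma trigP_coord (a b c : ℝ) : (fun s => ((a + b * Real.cos s + c * Real.sin s : ℝ) : ℂ)) ∈ trigP 1 := by
  have h1 : ce 1 ∈ trigP 1 := Submodule.subset_span ⟨1, by simp, rfl⟩
  have h2 : ce (-1) ∈ trigP 1 := Submodule.subset_span ⟨-1, by simp, rfl⟩
  have := (trigP 1).add_mem (trigP_const 1 a) ((trigP 1).add_mem 
    ((trigP 1).smul_mem (((b:ℂ) - c * Complex.I) / 2) h1) ((trigP 1).smul_mem (((b:ℂ) + c * Complex.I) / 2) h2))
  convert this using 1
  funext s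
  simp only [Pi.add_apply, Pi.smul_apply, smul_eq_mul, ce]
  push_cast
  rw [Complex.cos, Complex.sin]
  have e1 : Complex.I * (1:ℂ) * (s:ℂ) = s * Complex.I := by ring
  have e2 : Complex.I * (-(1:ℂ)) * (s:ℂ) = -(s:ℂ) * Complex.I := by ring
  rw [e1, e2]
  ring

lemma trigP_deriv (m : ℕ) (M : ℕ) (s w : ℕ → ℝ) 
    (h : ∀ k : ℤ, |k| ≤ m → ∑ j ∈ Finset.range M, (w j : ℂ) * ce k (s j) = Complex.I * k)
    (T : ℝ → ℂ) (hT : T ∈ trigP m) : HasDerivAt T (∑ j ∈ Finset.range M, (w j : ℂ) * T (s j)) 0 := by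
  induction hT using Submodule.span_induction with
  | mem f hf =>
    obtain ⟨k, hk, rfl⟩ := hf
    rw [h k hk]
    have h1 : HasDerivAt (fun s : ℝ => Complex.I * k * (s:ℂ)) (Complex.I * k * 1) 0 :=
      (Complex.ofRealCLM.hasDerivAt (x := (0:ℝ))).const_mul _
    have h2 := h1.cexp
    exact h2.congr_deriv (by simp)
  | zero => exact (hasDerivAt_const (0:ℝ) (0:ℂ)).congr_deriv (by simp)
  | add f g _ _ hf hg =>
    refine (hf.add hg).congr_deriv ?_
    rw [← Finset.sum_add_distrib]
    exact Finset.sum_congr rfl fun j _ => by simp [mul_add]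
  | smul a f _ hf =>
    refine (hf.const_smul a).congr_deriv ?_
    rw [smul_eq_mul, Finset.mul_sum]
    exact Finset.sum_congr rfl fun j _ => by simp; ring

end BernsteinPart

section RotPart

variable {d : ℕ}

/-- evaluation of a polynomial at a point of Euclidean space -/
noncomputable def pe (p : MvPolynomial (Fin (d + 1)) ℝ) (x : EuclideanSpace ℝ (Fin (d + 1))) : ℝ :=
  MvPolynomial.eval (fun i => x i) p

/-- infinitesimal rotation -/
noncomputable def rL (j k : Fin (d + 1)) (p : MvPolynomial (Fin (d + 1)) ℝ) : MvPolynomial (Fin (d + 1)) ℝ :=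
  MvPolynomial.X j * MvPolynomial.pderiv k p - MvPolynomial.X k * MvPolynomial.pderiv j p

lemma rL_add (j k : Fin (d + 1)) (p q : MvPolynomial (Fin (d + 1)) ℝ) : rL j k (p + q) = rL j k p + rL j k q := by
  simp only [rL, map_add]; ring

lemma rL_smul (j k : Fin (d + 1)) (a : ℝ) (p : MvPolynomial (Fin (d + 1)) ℝ) : rL j k (a • p) = a • rL j k p := by
  simp only [rL, Derivation.map_smul, mul_smul_comm, smul_sub]

lemma rL_sum {ι : Type*} (s : Finset ι) (j k : Fin (d + 1)) (p : ι → MvPolynomial (Fin (d + 1)) ℝ) :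
    rL j k (∑ i ∈ s, p i) = ∑ i ∈ s, rL j k (p i) := by
  simp only [rL, map_sum, Finset.mul_sum, Finset.sum_sub_distrib]

lemma rL_self (j : Fin (d + 1)) (p : MvPolynomial (Fin (d + 1)) ℝ) : rL j j p = 0 := by
  simp [rL]

lemma pe_add (p q : MvPolynomial (Fin (d + 1)) ℝ) (x) : pe (p + q) x = pe p x + pe q x := by simp [pe]
lemma pe_smul (a : ℝ) (p : MvPolynomial (Fin (d + 1)) ℝ) (x) : pe (a • p) x = a * pe p x := by simp [pe]
lemma pe_sum {ι : Type*} (s : Finset ι) (p : ι → MvPolynomial (Fin (d + 1)) ℝ) (x) :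
    pe (∑ i ∈ s, p i) x = ∑ i ∈ s, pe (p i) x := by simp [pe]
lemma pe_rL (j k : Fin (d + 1)) (p : MvPolynomial (Fin (d + 1)) ℝ) (x) : 
    pe (rL j k p) x = x j * pe (MvPolynomial.pderiv k p) x - x k * pe (MvPolynomial.pderiv j p) x := by 
  simp [pe, rL]

lemma pe_continuous (p : MvPolynomial (Fin (d + 1)) ℝ) : Continuous (pe p) := by
  have h := MvPolynomial.continuous_eval p
  exact h.comp (PiLp.continuous_ofLp 2 _)

lemma rL_degree (j k : Fin (d + 1)) (p : MvPolynomial (Fin (d + 1)) ℝ) : (rL j k p).totalDegree ≤ p.totalDegree := by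
  have aux : ∀ (j k : Fin (d + 1)) (s : Fin (d+1) →₀ ℕ) (a : ℝ), 
      (MvPolynomial.X j * MvPolynomial.pderiv k (MvPolynomial.monomial s a)).totalDegree ≤ s.sum fun _ e => e := by
    intro j k s a
    rw [MvPolynomial.pderiv_monomial]
    by_cases hs : s k = 0
    · simp [hs]
    · rw [MvPolynomial.X, MvPolynomial.monomial_mul]
      refine (MvPolynomial.totalDegree_monomial_le _ _).trans ?_
      change Finsupp.degree _ ≤ Finsupp.degree _
      rw [map_add, Finsupp.degree_single]
      have h1 : s = (s - Finsupp.single k 1) + Finsupp.single k 1 := by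
        rw [tsub_add_cancel_of_le]
        rw [Finsupp.single_le_iff]; omega
      conv_rhs => rw [h1, map_add, Finsupp.degree_single]
      omega
  rw [← MvPolynomial.mem_restrictTotalDegree]
  conv => rw [← MvPolynomial.support_sum_monomial_coeff p]
  rw [rL_sum]
  refine Submodule.sum_mem _ fun s hs => ?_
  rw [MvPolynomial.mem_restrictTotalDegree]
  rw [rL]
  refine (MvPolynomial.totalDegree_sub _ _).trans (max_le ?_ ?_)
  all_goals
    refine (aux _ _ _ _).trans ?_
    rw [MvPolynomial.support_sum_monomial_coeff p]
    exact MvPolynomial.le_totalDegree hs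

lemma pe_hasDerivAt (p : MvPolynomial (Fin (d + 1)) ℝ) (γ : ℝ → EuclideanSpace ℝ (Fin (d + 1))) (γ' : Fin (d+1) → ℝ)
    (s : ℝ) (h : ∀ i, HasDerivAt (fun s => γ s i) (γ' i) s) :
    HasDerivAt (fun s => pe p (γ s)) (∑ i, γ' i * pe (MvPolynomial.pderiv i p) (γ s)) s := by
  induction p using MvPolynomial.induction_on with
  | C a => simpa [pe] using hasDerivAt_const s a
  | add p q hp hq =>
    have := hp.add hq
    refine (this.congr_deriv ?_).congr_of_eventuallyEq (Filter.Eventually.of_forall fun s => by simp [pe_add])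
    rw [← Finset.sum_add_distrib]
    exact Finset.sum_congr rfl fun i _ => by rw [map_add, pe_add]; ring
  | mul_X p n hp =>
    have := hp.mul (h n)
    refine (this.congr_deriv ?_).congr_of_eventuallyEq (Filter.Eventually.of_forall fun s => by simp [pe])
    have h1 : ∀ i, γ' i * pe (MvPolynomial.pderiv i (p * MvPolynomial.X n)) (γ s) = 
        γ' i * pe (MvPolynomial.pderiv i p) (γ s) * γ s n + (if i = n then pe p (γ s) * γ' n else 0) := by
      intro i
      rw [MvPolynomial.pderiv_mul, pe_add]
      by_cases hi : i = n
      · subst hi; simp [pe]; ring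
      · rw [MvPolynomial.pderiv_X_of_ne (fun h => hi h.symm)]; simp [pe, hi]; ring
    simp_rw [h1]
    rw [Finset.sum_add_distrib, ← Finset.sum_mul]
    simp

/-- plane rotation -/
noncomputable def rot (j k : Fin (d + 1)) (s : ℝ) (x : EuclideanSpace ℝ (Fin (d + 1))) : EuclideanSpace ℝ (Fin (d + 1)) :=
  if j = k then x else
  WithLp.toLp 2 fun i => if i = j then Real.cos s * x j - Real.sin s * x k else 
    if i = k then Real.sin s * x j + Real.cos s * x k else x i

lemma rot_apply (j k : Fin (d + 1)) (h : j ≠ k) (s : ℝ) (x : EuclideanSpace ℝ (Fin (d + 1))) (i : Fin (d+1)) :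
    rot j k s x i = if i = j then Real.cos s * x j - Real.sin s * x k else 
    if i = k then Real.sin s * x j + Real.cos s * x k else x i := by
  simp [rot, h]

lemma rot_zero (j k : Fin (d + 1)) (x : EuclideanSpace ℝ (Fin (d + 1))) : rot j k 0 x = x := by
  by_cases h : j = k
  · simp [rot, h]
  · ext i; rw [rot_apply j k h]; split_ifs with h1 h2
    · simp [h1]
    · simp [h2]
    · rfl

lemma rot_norm (j k : Fin (d + 1)) (s : ℝ) (x : EuclideanSpace ℝ (Fin (d + 1))) : ‖rot j k s x‖ = ‖x‖ := by
  by_cases h : j = k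
  · simp [rot, h]
  · have : ‖rot j k s x‖ ^ 2 = ‖x‖ ^ 2 := by
      rw [EuclideanSpace.real_norm_sq_eq, EuclideanSpace.real_norm_sq_eq, ← sub_eq_zero, ← Finset.sum_sub_distrib]
      have h1 : ∀ i, rot j k s x i ^ 2 - x i ^ 2 = 
          (if i = j then (Real.cos s * x j - Real.sin s * x k)^2 - x j ^2 else 0) + 
          (if i = k then (Real.sin s * x j + Real.cos s * x k)^2 - x k ^2 else 0) := by
        intro i
        rw [rot_apply j k h]
        by_cases hij : i = j
        · subst hij; simp [h]
        · by_cases hik : i = k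
          · subst hik; simp [hij]
          · simp [hij, hik]
      simp_rw [h1]
      rw [Finset.sum_add_distrib]
      simp only [Finset.sum_ite_eq', Finset.mem_univ, if_true]
      have := Real.sin_sq_add_cos_sq s
      linear_combination (x j ^2 + x k ^ 2) * this
    exact (sq_eq_sq₀ (norm_nonneg _) (norm_nonneg _)).mp this

/-- plane rotation as linear map -/
noncomputable def rotLin (j k : Fin (d + 1)) (s : ℝ) : EuclideanSpace ℝ (Fin (d + 1)) →ₗᵢ[ℝ] EuclideanSpace ℝ (Fin (d + 1)) where
  toFun := rot j k s
  map_add' x y := by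
    by_cases h : j = k
    · simp [rot, h]
    · ext i; simp only [PiLp.add_apply, rot_apply j k h]; split_ifs <;> ring
  map_smul' a x := by
    by_cases h : j = k
    · simp [rot, h]
    · ext i; simp only [PiLp.smul_apply, rot_apply j k h, RingHom.id_apply, smul_eq_mul]; split_ifs <;> ring
  norm_map' := rot_norm j k s

lemma rot_sub (j k : Fin (d + 1)) (s : ℝ) (x y : EuclideanSpace ℝ (Fin (d + 1))) : 
    rot j k s x - rot j k s y = rot j k s (x - y) := ((rotLin j k s).map_sub x y).symm

lemma rot_dist (j k : Fin (d + 1)) (s : ℝ) (x y : EuclideanSpace ℝ (Fin (d + 1))) : 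
    ‖rot j k s x - rot j k s y‖ = ‖x - y‖ := by rw [rot_sub, rot_norm]

lemma rot_mp (j k : Fin (d + 1)) (s : ℝ) : MeasurePreserving (rot j k s) (sphereMeasure d) (sphereMeasure d) :=
  sm_map d ((rotLin j k s).toLinearIsometryEquiv rfl)

lemma rot_hasDerivAt (p : MvPolynomial (Fin (d + 1)) ℝ) (j k : Fin (d + 1)) (x : EuclideanSpace ℝ (Fin (d + 1))) (s : ℝ) :
    HasDerivAt (fun s => pe p (rot j k s x)) (pe (rL j k p) (rot j k s x)) s := by
  by_cases h : j = k
  · subst h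
    rw [rL_self]
    simpa [rot, pe] using hasDerivAt_const s (pe p x)
  · have h1 := pe_hasDerivAt p (fun s => rot j k s x) 
      (fun i => (if i = j then - rot j k s x k else 0) + (if i = k then rot j k s x j else 0)) s (by
        intro i
        simp only [rot_apply j k h]
        have hc := Real.hasDerivAt_cos s
        have hs := Real.hasDerivAt_sin s
        by_cases hij : i = j
        · subst hij
          have hki : k ≠ i := fun h' => h h'.symm
          simp only [if_true, h, if_false, hki]
          refine ((hc.mul_const _).sub (hs.mul_const _)).congr_deriv (by ring)
        · by_cases hik : i = k
          · subst hik
            simp only [if_true, hij, if_false]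
            refine ((hs.mul_const _).add (hc.mul_const _)).congr_deriv (by ring)
          · simp only [hij, hik, if_false]
            simpa using hasDerivAt_const s (x i))
    refine h1.congr_deriv ?_
    rw [pe_rL]
    simp_rw [add_mul, ite_mul, zero_mul]
    rw [Finset.sum_add_distrib]
    simp only [Finset.sum_ite_eq', Finset.mem_univ, if_true]
    ring

lemma rot_trig (p : MvPolynomial (Fin (d + 1)) ℝ) (j k : Fin (d + 1)) (x : EuclideanSpace ℝ (Fin (d + 1))) :
    (fun s => ((pe p (rot j k s x) : ℝ) : ℂ)) ∈ trigP p.totalDegree := by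
  by_cases h : j = k
  · simp only [rot, h, if_true]; exact trigP_const _ _
  have hco : ∀ i, (fun s => ((rot j k s x i : ℝ) : ℂ)) ∈ trigP 1 := by
    intro i
    simp only [rot_apply j k h]
    by_cases hij : i = j
    · simp only [hij, if_true]
      convert trigP_coord 0 (x j) (-x k) using 4; ring
    · by_cases hik : i = k
      · have hkj : k ≠ j := fun h' => h h'.symm
        simp only [hik, if_true, hkj, if_false]
        convert trigP_coord 0 (x k) (x j) using 3; ring
      · simp only [hij, hik, if_false]
        exact trigP_const _ _
  have : (fun s => ((pe p (rot j k s x) : ℝ) : ℂ)) = ∑ m ∈ p.support, 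
      ((p.coeff m : ℝ) : ℂ) • ∏ i, (fun s => ((rot j k s x i : ℝ) : ℂ)) ^ (m i) := by
    funext s
    rw [pe, MvPolynomial.eval_eq']
    simp
  rw [this]
  refine Submodule.sum_mem _ fun m hm => Submodule.smul_mem _ _ ?_
  have h1 := trigP_prod Finset.univ (fun i => (fun s => ((rot j k s x i : ℝ) : ℂ)) ^ (m i)) (fun i => m i * 1)
    (fun i _ => trigP_pow (hco i) (m i))
  refine trigP_mono ?_ h1
  have h2 := MvPolynomial.le_totalDegree hm
  rw [Finsupp.sum_fintype _ _ (fun _ => rfl)] at h2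
  simpa using h2

/-- pointwise Bernstein formula -/
lemma bern_point (t : ℕ) (ht : 0 < t) : ∃ (M : ℕ) (s w : ℕ → ℝ), ∑ j ∈ Finset.range M, |w j| ≤ 2 * t ∧
    ∀ (p : MvPolynomial (Fin (d + 1)) ℝ), p.totalDegree ≤ t → ∀ (j k : Fin (d + 1)) (x : EuclideanSpace ℝ (Fin (d + 1))),
      pe (rL j k p) x = ∑ i ∈ Finset.range M, w i * pe p (rot j k (s i) x) := by
  obtain ⟨M, s, w, hw, h⟩ := bern_weights t ht
  refine ⟨M, s, w, hw, fun p hp j k x => ?_⟩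
  have h1 := trigP_deriv t M s w h _ (trigP_mono hp (rot_trig p j k x))
  have h2 := (rot_hasDerivAt p j k x 0).ofReal_comp
  have h3 := h2.unique h1
  rw [rot_zero] at h3
  exact_mod_cast h3

lemma cont_int (f : EuclideanSpace ℝ (Fin (d + 1)) → ℝ) (hf : Continuous f) : Integrable f (sphereMeasure d) := by
  obtain ⟨C, hC⟩ := (isCompact_sphere (0 : EuclideanSpace ℝ (Fin (d + 1))) 1).exists_bound_of_continuousOn hf.continuousOn
  refine Integrable.of_bound hf.aestronglyMeasurable C ?_
  filter_upwards [sm_ae d] with y hy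
  exact hC y (by simpa using hy)

lemma bern_L1 (t : ℕ) (ht : 0 < t) (p : MvPolynomial (Fin (d + 1)) ℝ) (hp : p.totalDegree ≤ t) (j k : Fin (d + 1)) :
    ∫ x, |pe (rL j k p) x| ∂(sphereMeasure d) ≤ 2 * t * ∫ x, |pe p x| ∂(sphereMeasure d) := by
  obtain ⟨M, s, w, hw, h⟩ := bern_point (d := d) t ht
  have hrc : ∀ i, Continuous (rot j k (s i)) := fun i => (rotLin j k (s i)).continuous
  have hInteg : ∀ i ∈ Finset.range M, Integrable (fun x => |w i| * |pe p (rot j k (s i) x)|) (sphereMeasure d) := fun i _ =>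
    cont_int _ (continuous_const.mul ((pe_continuous p).comp (hrc i)).abs)
  calc ∫ x, |pe (rL j k p) x| ∂(sphereMeasure d) 
      ≤ ∫ x, ∑ i ∈ Finset.range M, |w i| * |pe p (rot j k (s i) x)| ∂(sphereMeasure d) := by
        apply integral_mono (cont_int _ (pe_continuous _).abs) (integrable_finsetSum _ hInteg)
        intro x
        dsimp only
        rw [h p hp j k x]
        refine (Finset.abs_sum_le_sum_abs _ _).trans (le_of_eq ?_)
        exact Finset.sum_congr rfl fun i _ => abs_mul _ _
    _ = ∑ i ∈ Finset.range M, |w i| * ∫ x, |pe p x| ∂(sphereMeasure d) := by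
        rw [integral_finsetSum _ hInteg]
        refine Finset.sum_congr rfl fun i _ => ?_
        rw [integral_const_mul]
        congr 1
        exact (rot_mp j k (s i)).integral_comp 
          ((rotLin j k (s i)).toLinearIsometryEquiv rfl).toHomeomorph.measurableEmbedding (fun x => |pe p x|)
    _ ≤ _ := by
        rw [← Finset.sum_mul]
        gcongr
        
lemma bern_sup (t : ℕ) (ht : 0 < t) (p : MvPolynomial (Fin (d + 1)) ℝ) (hp : p.totalDegree ≤ t) (j k : Fin (d + 1))
    (C : ℝ) (hC : ∀ x, ‖x‖ = 1 → |pe p x| ≤ C) :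
    ∀ x, ‖x‖ = 1 → |pe (rL j k p) x| ≤ 2 * t * C := by
  obtain ⟨M, s, w, hw, h⟩ := bern_point (d := d) t ht
  intro x hx
  have hC0 : 0 ≤ C := (abs_nonneg _).trans (hC x hx)
  rw [h p hp j k x]
  refine (Finset.abs_sum_le_sum_abs _ _).trans ?_
  calc _ ≤ ∑ i ∈ Finset.range M, |w i| * C := Finset.sum_le_sum fun i _ => by
        rw [abs_mul]; gcongr; exact hC _ (by rw [rot_norm, hx])
    _ ≤ _ := by rw [← Finset.sum_mul]; gcongr

end RotPart

section MajorantPart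

lemma taylor_abs (K : ℕ) : ∀ (g : ℕ → ℝ → ℝ) (_ : ∀ n s, HasDerivAt (g n) (g (n+1) s) s) (C : ℝ) 
    (_ : ∀ s, |g (K+1) s| ≤ C) (θ : ℝ), 0 ≤ θ →
    |g 0 θ - g 0 0| ≤ ∑ i ∈ Finset.range K, θ ^ (i+1) / (i+1).factorial * |g (i+1) 0| + θ^(K+1) / (K+1).factorial * C := by
  induction K with
  | zero =>
    intro g hg C hC θ hθ
    have h := image_norm_le_of_norm_deriv_right_le_deriv_boundary (a := 0) (b := θ) (f := fun s => g 0 s - g 0 0) (f' := fun s => g 1 s)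
      (B := fun s => s * C) (B' := fun _ => C)
      (fun s _ => ((hg 0 s).sub_const _).continuousAt.continuousWithinAt)
      (fun s _ => ((hg 0 s).sub_const _).hasDerivWithinAt) (by simp)
      (fun s => by simpa using (hasDerivAt_id s).mul_const C) (fun s _ => hC s)
    have := h (Set.right_mem_Icc.mpr hθ)
    simpa using this
  | succ K ih =>
    intro g hg C hC θ hθ
    have ih' := ih (fun n => g (n+1)) (fun n s => hg (n+1) s) C hC
    have h := image_norm_le_of_norm_deriv_right_le_deriv_boundary (a := 0) (b := θ) (f := fun s => g 0 s - g 0 0) (f' := fun s => g 1 s)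
      (B := fun θ => ∑ i ∈ Finset.range (K+1), θ ^ (i+1) / (i+1).factorial * |g (i+1) 0| + θ^(K+1+1) / (K+1+1).factorial * C) 
      (B' := fun θ => ∑ i ∈ Finset.range (K+1), θ ^ i / i.factorial * |g (i+1) 0| + θ^(K+1) / (K+1).factorial * C)
      (fun s _ => ((hg 0 s).sub_const _).continuousAt.continuousWithinAt)
      (fun s _ => ((hg 0 s).sub_const _).hasDerivWithinAt) (by simp)
      (fun s => by
        have hp : ∀ i : ℕ, ∀ c : ℝ, HasDerivAt (fun s : ℝ => s ^ (i+1) / (i+1).factorial * c) (s ^ i / i.factorial * c) s := by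
          intro i c
          refine (((hasDerivAt_pow (i+1) s).div_const _).mul_const c).congr_deriv ?_
          have : ((i.factorial : ℕ) : ℝ) ≠ 0 := by exact_mod_cast i.factorial_ne_zero
          rw [Nat.factorial_succ]; push_cast
          have : (i:ℝ) + 1 ≠ 0 := by positivity
          field_simp
        refine HasDerivAt.add ?_ (hp (K+1) C)
        exact HasDerivAt.fun_sum fun i _ => hp i _) 
      (fun s hs => by
        have h1 := ih' s hs.1
        rw [Finset.sum_range_succ', Real.norm_eq_abs]
        have h2 : |g 1 s| ≤ |g 1 s - g 1 0| + |g 1 0| := by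
          have := abs_add_le (g 1 s - g 1 0) (g 1 0)
          simpa using this
        simp only [zero_add] at h1
        simp only [pow_zero, Nat.factorial_zero, Nat.cast_one, div_one, one_mul, zero_add]
        linarith)
    exact h (Set.right_mem_Icc.mpr hθ)

variable {d : ℕ}

/-- sum of absolute values of all iterated rotation derivatives of order `n` -/
noncomputable def Bn : ℕ → MvPolynomial (Fin (d + 1)) ℝ → EuclideanSpace ℝ (Fin (d + 1)) → ℝ
  | 0, F, x => |pe F x|
  | n+1, F, x => ∑ q : Fin (d+1) × Fin (d+1), Bn n (rL q.1 q.2 F) x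

lemma Bn_nonneg (n : ℕ) : ∀ (F : MvPolynomial (Fin (d + 1)) ℝ) x, 0 ≤ Bn n F x := by
  induction n with
  | zero => intro F x; exact abs_nonneg _
  | succ n ih => intro F x; exact Finset.sum_nonneg fun q _ => ih _ _

lemma Bn_cont (n : ℕ) : ∀ (F : MvPolynomial (Fin (d + 1)) ℝ), Continuous (Bn n F) := by
  induction n with
  | zero => intro F; exact (pe_continuous F).abs
  | succ n ih => intro F; exact continuous_finsetSum _ fun q _ => ih _

lemma Bn_sum {ι : Type*} (s : Finset ι) (c : ι → ℝ) (n : ℕ) : ∀ (F : ι → MvPolynomial (Fin (d + 1)) ℝ) x,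
    Bn n (∑ i ∈ s, c i • F i) x ≤ ∑ i ∈ s, |c i| * Bn n (F i) x := by
  induction n with
  | zero =>
    intro F x
    simp only [Bn, pe_sum, pe_smul]
    refine (Finset.abs_sum_le_sum_abs _ _).trans (le_of_eq ?_)
    exact Finset.sum_congr rfl fun i _ => abs_mul _ _
  | succ n ih =>
    intro F x
    simp only [Bn, rL_sum, rL_smul]
    simp_rw [Finset.mul_sum]
    rw [Finset.sum_comm]
    exact Finset.sum_le_sum fun q _ => ih _ _

lemma Bn_int (t : ℕ) (ht : 0 < t) (n : ℕ) : ∀ (F : MvPolynomial (Fin (d + 1)) ℝ), F.totalDegree ≤ t → 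
    ∫ x, Bn n F x ∂(sphereMeasure d) ≤ (2 * t * ((d:ℝ)+1)^2) ^ n * ∫ x, |pe F x| ∂(sphereMeasure d) := by
  induction n with
  | zero => intro F _; simp [Bn]
  | succ n ih =>
    intro F hF
    simp only [Bn]
    rw [integral_finsetSum _ fun q _ => cont_int _ (Bn_cont n _)]
    calc _ ≤ ∑ q : Fin (d+1) × Fin (d+1), (2 * t * ((d:ℝ)+1)^2) ^ n * (2 * t * ∫ x, |pe F x| ∂(sphereMeasure d)) := by
          refine Finset.sum_le_sum fun q _ => ?_
          refine (ih _ ((rL_degree _ _ _).trans hF)).trans ?_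
          gcongr
          exact bern_L1 t ht F hF _ _
      _ = _ := by
          simp only [Finset.sum_const, Finset.card_univ, Fintype.card_prod, Fintype.card_fin, nsmul_eq_mul]
          push_cast; ring

lemma Bn_sup (t : ℕ) (ht : 0 < t) (n : ℕ) : ∀ (F : MvPolynomial (Fin (d + 1)) ℝ), F.totalDegree ≤ t → 
    ∀ C, (∀ x, ‖x‖ = 1 → |pe F x| ≤ C) → ∀ x, ‖x‖ = 1 → Bn n F x ≤ (2 * t * ((d:ℝ)+1)^2) ^ n * C := by
  induction n with
  | zero => intro F _ C hC x hx; simpa [Bn] using hC x hx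
  | succ n ih =>
    intro F hF C hC x hx
    simp only [Bn]
    calc _ ≤ ∑ q : Fin (d+1) × Fin (d+1), (2 * t * ((d:ℝ)+1)^2) ^ n * (2 * t * C) := by
          refine Finset.sum_le_sum fun q _ => ?_
          exact ih _ ((rL_degree _ _ _).trans hF) _ (bern_sup t ht F hF _ _ C hC) x hx
      _ = _ := by
          simp only [Finset.sum_const, Finset.card_univ, Fintype.card_prod, Fintype.card_fin, nsmul_eq_mul]
          push_cast; ring

/-- derivative along a great circle -/
noncomputable def gcA (x u : EuclideanSpace ℝ (Fin (d + 1))) (F : MvPolynomial (Fin (d + 1)) ℝ) : MvPolynomial (Fin (d + 1)) ℝ :=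
  ∑ q : Fin (d+1) × Fin (d+1), (x q.1 * u q.2) • rL q.1 q.2 F

lemma gcA_Bn (x u : EuclideanSpace ℝ (Fin (d + 1))) (hx : ‖x‖ = 1) (hu : ‖u‖ = 1) (n : ℕ) :
    ∀ (m : ℕ) (F : MvPolynomial (Fin (d + 1)) ℝ) y, Bn m ((gcA x u)^[n] F) y ≤ Bn (m + n) F y := by
  have h1 : ∀ m (F : MvPolynomial (Fin (d + 1)) ℝ) y, Bn m (gcA x u F) y ≤ Bn (m+1) F y := by
    intro m F y
    rw [gcA]
    refine (Bn_sum _ _ m _ y).trans ?_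
    simp only [Bn]
    refine Finset.sum_le_sum fun q _ => ?_
    refine mul_le_of_le_one_left (Bn_nonneg _ _ _) ?_
    rw [abs_mul]
    have h1 := PiLp.norm_apply_le x q.1
    have h2 := PiLp.norm_apply_le u q.2
    rw [hx, Real.norm_eq_abs] at h1
    rw [hu, Real.norm_eq_abs] at h2
    exact mul_le_one₀ h1 (abs_nonneg _) h2
  induction n with
  | zero => intro m F y; simp
  | succ n ih =>
    intro m F y
    rw [Function.iterate_succ_apply']
    refine (h1 _ _ _).trans ?_
    have := ih (m+1) F y
    rwa [show m + 1 + n = m + (n+1) by ring] at this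

lemma gc_hasDerivAt (x u : EuclideanSpace ℝ (Fin (d + 1))) (hx : ‖x‖ = 1) (hu : ‖u‖ = 1) (hxu : inner ℝ x u = (0:ℝ))
    (F : MvPolynomial (Fin (d + 1)) ℝ) (θ : ℝ) : HasDerivAt (fun θ => pe F (Real.cos θ • x + Real.sin θ • u))
      (pe (gcA x u F) (Real.cos θ • x + Real.sin θ • u)) θ := by
  have h1 := pe_hasDerivAt F (fun θ => Real.cos θ • x + Real.sin θ • u) (fun i => -Real.sin θ * x i + Real.cos θ * u i) θ
    (fun i => by
      simp only [PiLp.add_apply, PiLp.smul_apply, smul_eq_mul]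
      exact ((Real.hasDerivAt_cos θ).mul_const _).add ((Real.hasDerivAt_sin θ).mul_const _))
  refine h1.congr_deriv ?_
  set y := Real.cos θ • x + Real.sin θ • u with hy
  have hy' : ∀ i, y i = Real.cos θ * x i + Real.sin θ * u i := fun i => by simp [hy]
  have hxx : ∑ i, x i * x i = 1 := by
    have := EuclideanSpace.real_norm_sq_eq x
    rw [hx] at this; simp_rw [← sq]; linarith
  have huu : ∑ i, u i * u i = 1 := by
    have := EuclideanSpace.real_norm_sq_eq u
    rw [hu] at this; simp_rw [← sq]; linarith
  have hxu' : ∑ i, x i * u i = 0 := by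
    rw [← hxu, PiLp.inner_apply]; exact Finset.sum_congr rfl fun i _ => by simp [mul_comm]
  have hxy : ∑ i, x i * y i = Real.cos θ := by
    calc _ = ∑ i, (Real.cos θ * (x i * x i) + Real.sin θ * (x i * u i)) := 
          Finset.sum_congr rfl fun i _ => by rw [hy']; ring
      _ = _ := by rw [Finset.sum_add_distrib, ← Finset.mul_sum, ← Finset.mul_sum, hxx, hxu']; ring
  have huy : ∑ i, u i * y i = Real.sin θ := by
    calc _ = ∑ i, (Real.cos θ * (x i * u i) + Real.sin θ * (u i * u i)) := 
          Finset.sum_congr rfl fun i _ => by rw [hy']; ring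
      _ = _ := by rw [Finset.sum_add_distrib, ← Finset.mul_sum, ← Finset.mul_sum, huu, hxu']; ring
  let D : Fin (d+1) → ℝ := fun i => pe (MvPolynomial.pderiv i F) y
  have h2 : pe (gcA x u F) y = ∑ j, ∑ i, ((x j * y j) * (u i * D i) - (x j * D j) * (u i * y i)) := by
    rw [gcA, pe_sum, Fintype.sum_prod_type]
    refine Finset.sum_congr rfl fun j _ => Finset.sum_congr rfl fun i _ => ?_
    rw [pe_smul, pe_rL]; simp only [D]; ring
  rw [h2]
  simp_rw [Finset.sum_sub_distrib]
  rw [← Finset.sum_mul_sum, ← Finset.sum_mul_sum, hxy, huy, Finset.mul_sum, Finset.sum_mul, ← Finset.sum_sub_distrib]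
  refine Finset.sum_congr rfl fun i _ => ?_
  simp only [D]; ring

lemma gc_norm (x u : EuclideanSpace ℝ (Fin (d + 1))) (hx : ‖x‖ = 1) (hu : ‖u‖ = 1) (hxu : inner ℝ x u = (0:ℝ)) (θ : ℝ) :
    ‖Real.cos θ • x + Real.sin θ • u‖ = 1 := by
  have : ‖Real.cos θ • x + Real.sin θ • u‖ ^ 2 = 1 := by
    rw [norm_add_sq_real, norm_smul, norm_smul, inner_smul_left, inner_smul_right, hxu, hx, hu]
    simp only [Real.norm_eq_abs, mul_one, sq_abs, mul_zero, add_zero]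
    linarith [Real.sin_sq_add_cos_sq θ]
  have h0 := norm_nonneg (Real.cos θ • x + Real.sin θ • u)
  nlinarith

lemma gc_exists (x z : EuclideanSpace ℝ (Fin (d + 1))) (hx : ‖x‖ = 1) (hz : ‖z‖ = 1) (hxz : x ≠ z) (hxz' : x ≠ -z) :
    ∃ u : EuclideanSpace ℝ (Fin (d + 1)), ‖u‖ = 1 ∧ inner ℝ x u = (0:ℝ) ∧ ∃ θ, 0 ≤ θ ∧ θ ≤ 2 * ‖z - x‖ ∧ 
      z = Real.cos θ • x + Real.sin θ • u := by
  set c : ℝ := inner ℝ x z with hc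
  have hcx : (inner ℝ x x : ℝ) = 1 := by rw [real_inner_self_eq_norm_sq, hx]; norm_num
  have hn1 : ‖z - x‖ ^ 2 = 2 - 2 * c := by
    rw [norm_sub_sq_real, hx, hz, real_inner_comm]; ring
  have hn2 : ‖z + x‖ ^ 2 = 2 + 2 * c := by
    rw [norm_add_sq_real, hx, hz, real_inner_comm]; ring
  have hc1 : c < 1 := by
    have : 0 < ‖z - x‖ := norm_pos_iff.mpr (sub_ne_zero.mpr (Ne.symm hxz))
    nlinarith
  have hc2 : -1 < c := by
    have : 0 < ‖z + x‖ := norm_pos_iff.mpr (fun h => hxz' (eq_neg_of_add_eq_zero_right h))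
    nlinarith
  set θ := Real.arccos c with hθ
  have hcos : Real.cos θ = c := Real.cos_arccos hc2.le hc1.le
  have hsin : Real.sin θ = Real.sqrt (1 - c^2) := Real.sin_arccos c
  have hs0 : 0 < Real.sin θ := by rw [hsin]; apply Real.sqrt_pos.mpr; nlinarith
  have hs2 : Real.sin θ ^ 2 = 1 - c ^ 2 := by rw [hsin, Real.sq_sqrt]; nlinarith
  refine ⟨(Real.sin θ)⁻¹ • (z - c • x), ?_, ?_, θ, Real.arccos_nonneg c, ?_, ?_⟩
  · have h1 : ‖z - c • x‖ ^ 2 = Real.sin θ ^ 2 := by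
      rw [norm_sub_sq_real, norm_smul, inner_smul_right, hx, hz, real_inner_comm, ← hc, hs2, Real.norm_eq_abs, mul_one, sq_abs]
      ring
    have h2 : ‖z - c • x‖ = Real.sin θ := (sq_eq_sq₀ (norm_nonneg _) hs0.le).mp h1
    rw [norm_smul, h2, norm_inv, Real.norm_eq_abs, abs_of_pos hs0, inv_mul_cancel₀ hs0.ne']
  · rw [inner_smul_right, inner_sub_right, inner_smul_right, hcx, ← hc]; ring
  · have hpi : θ ≤ Real.pi := Real.arccos_le_pi c
    have h0 : 0 ≤ θ := Real.arccos_nonneg c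
    have h1 := Real.mul_le_sin (x := θ / 2) (by linarith) (by linarith)
    have h2 : 2 - 2 * c = (2 * Real.sin (θ/2))^2 := by
      rw [← hcos, show θ = 2 * (θ/2) by ring, Real.cos_two_mul']
      have := Real.sin_sq_add_cos_sq (θ/2)
      rw [show 2 * (θ/2)/2 = θ/2 by ring]
      nlinarith
    have hs : 0 ≤ Real.sin (θ/2) := Real.sin_nonneg_of_nonneg_of_le_pi (by linarith) (by linarith)
    have h3 : ‖z - x‖ = 2 * Real.sin (θ/2) := (sq_eq_sq₀ (norm_nonneg _) (by positivity)).mp (hn1.trans h2)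
    rw [h3]
    have h4 : 1 / 2 ≤ 2 / Real.pi := by
      rw [div_le_div_iff₀ (by norm_num) Real.pi_pos]; linarith [Real.pi_le_four]
    have : 1/2 * (θ / 2) ≤ 2 / Real.pi * (θ / 2) := mul_le_mul_of_nonneg_right h4 (by linarith)
    linarith
  · rw [smul_smul, mul_inv_cancel₀ hs0.ne', one_smul, hcos]; abel

lemma majorant (t : ℕ) (ht : 0 < t) (F : MvPolynomial (Fin (d + 1)) ℝ) (hF : F.totalDegree ≤ t) (η : ℝ) (hη : 0 < η)
    (hη1 : η ≤ 1) (hηt : 4 * η * t * ((d:ℝ)+1)^2 ≤ 1) (ε : ℝ) (hε : 0 < ε) :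
    ∃ A : EuclideanSpace ℝ (Fin (d + 1)) → ℝ, Continuous A ∧ (∀ x, 0 ≤ A x) ∧
      (∀ x z, ‖x‖ = 1 → ‖z‖ = 1 → ‖z - x‖ ≤ η → |pe F z - pe F x| ≤ A x) ∧
      ∫ x, A x ∂(sphereMeasure d) ≤ 
        4 * η * ∑ q : Fin (d+1) × Fin (d+1), ∫ x, |pe (rL q.1 q.2 F) x| ∂(sphereMeasure d) + ε := by
  obtain ⟨C, hC⟩ := (isCompact_sphere (0 : EuclideanSpace ℝ (Fin (d + 1))) 1).exists_bound_of_continuousOn (pe_continuous F).continuousOn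
  have hC' : ∀ x, ‖x‖ = 1 → |pe F x| ≤ C := fun x hx => hC x (by simpa using hx)
  have hC0 : 0 ≤ C := (abs_nonneg _).trans (hC' (EuclideanSpace.single 0 1) (by simp))
  obtain ⟨K, hK⟩ : ∃ K : ℕ, C / (K+1).factorial ≤ ε := by
    obtain ⟨K, hK⟩ := exists_nat_ge (C / ε)
    refine ⟨K, ?_⟩
    have h1 : ((K+1 : ℕ) : ℝ) ≤ (K+1).factorial := by exact_mod_cast Nat.self_le_factorial (K+1)
    rw [div_le_iff₀ hε] at hK
    rw [div_le_iff₀ (by positivity)]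
    push_cast at h1
    nlinarith
  set Q : ℝ := 2 * t * ((d:ℝ)+1)^2 with hQ
  have hQ0 : 0 ≤ Q := by positivity
  have hQη : 2 * η * Q ≤ 1 := by rw [hQ]; linarith
  have hcont : Continuous fun x => ∑ i ∈ Finset.range K, (2*η) ^ (i+1) / (i+1).factorial * Bn (i+1) F x + ε :=
    (continuous_finsetSum _ fun i _ => continuous_const.mul (Bn_cont _ _)).add continuous_const
  refine ⟨fun x => ∑ i ∈ Finset.range K, (2*η) ^ (i+1) / (i+1).factorial * Bn (i+1) F x + ε, hcont, ?_, ?_, ?_⟩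
  · intro x
    have : 0 ≤ ∑ i ∈ Finset.range K, (2*η) ^ (i+1) / (i+1).factorial * Bn (i+1) F x :=
      Finset.sum_nonneg fun i _ => mul_nonneg (by positivity) (Bn_nonneg _ _ _)
    linarith
  · intro x z hx hz hxz
    have hA0 : 0 ≤ ∑ i ∈ Finset.range K, (2*η) ^ (i+1) / (i+1).factorial * Bn (i+1) F x :=
      Finset.sum_nonneg fun i _ => mul_nonneg (by positivity) (Bn_nonneg _ _ _)
    by_cases hne : x = z
    · subst hne; simp only [sub_self, abs_zero]; linarith
    have hne' : x ≠ -z := by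
      intro h
      rw [h, sub_neg_eq_add, ← two_smul ℝ z, norm_smul, hz] at hxz
      norm_num at hxz
      linarith
    obtain ⟨u, hu, hxu, θ, hθ0, hθ, hzθ⟩ := gc_exists x z hx hz hne hne'
    have hθη : θ ≤ 2 * η := by linarith
    have h1 := taylor_abs K (fun n θ => pe ((gcA x u)^[n] F) (Real.cos θ • x + Real.sin θ • u))
      (fun n s => by
        have := gc_hasDerivAt x u hx hu hxu ((gcA x u)^[n] F) s
        rw [← Function.iterate_succ_apply' (gcA x u) n F] at this
        exact this) (Q ^ (K+1) * C) (fun s => by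
        have h2 := gcA_Bn x u hx hu (K+1) 0 F (Real.cos s • x + Real.sin s • u)
        rw [zero_add] at h2
        refine h2.trans ?_
        exact Bn_sup t ht (K+1) F hF C hC' _ (gc_norm x u hx hu hxu s)) θ hθ0
    simp only [Function.iterate_zero, id, ← hzθ, Real.cos_zero, Real.sin_zero, one_smul, zero_smul, add_zero] at h1
    refine h1.trans (add_le_add ?_ ?_)
    · refine Finset.sum_le_sum fun i _ => ?_
      have h2 := gcA_Bn x u hx hu (i+1) 0 F x
      rw [zero_add] at h2
      have h3 : |pe ((gcA x u)^[i+1] F) x| ≤ Bn (i+1) F x := h2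
      gcongr
    · refine le_trans ?_ hK
      calc θ ^ (K + 1) / ↑(K + 1).factorial * (Q ^ (K + 1) * C) = (θ * Q) ^ (K+1) * (C / (K+1).factorial) := by
            rw [mul_pow θ Q]; clear_value Q; ring
        _ ≤ 1 * (C / (K+1).factorial) := by
            gcongr
            apply pow_le_one₀ (by positivity)
            refine le_trans ?_ hQη
            gcongr
        _ = _ := one_mul _
  · set Sg := ∑ q : Fin (d+1) × Fin (d+1), ∫ x, |pe (rL q.1 q.2 F) x| ∂(sphereMeasure d) with hSg
    have hSg0 : 0 ≤ Sg := Finset.sum_nonneg fun q _ => integral_nonneg fun x => abs_nonneg _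
    have hInteg : ∀ i ∈ Finset.range K, Integrable (fun x => (2*η) ^ (i+1) / (i+1).factorial * Bn (i+1) F x) (sphereMeasure d) :=
      fun i _ => cont_int _ (continuous_const.mul (Bn_cont _ _))
    rw [integral_add (integrable_finsetSum _ hInteg) (integrable_const _), integral_finsetSum _ hInteg]
    simp only [integral_const, probReal_univ, one_smul]
    gcongr
    have h1 : ∀ i ∈ Finset.range K, ∫ x, (2*η) ^ (i+1) / (i+1).factorial * Bn (i+1) F x ∂(sphereMeasure d) ≤ 
        2 * η * Sg * (1/2)^i := by
      intro i _
      rw [integral_const_mul]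
      have h2 : ∫ x, Bn (i+1) F x ∂(sphereMeasure d) ≤ Q ^ i * Sg := by
        simp only [Bn]
        rw [integral_finsetSum _ fun q _ => cont_int _ (Bn_cont i _), hSg, Finset.mul_sum]
        exact Finset.sum_le_sum fun q _ => Bn_int t ht i _ ((rL_degree _ _ _).trans hF)
      have h3 : ((2:ℝ)^i) ≤ (i+1).factorial := by
        have := Nat.factorial_mul_pow_le_factorial (m := 1) (n := i)
        rw [Nat.factorial_one, one_mul, add_comm 1 i] at this
        exact_mod_cast this
      calc _ ≤ (2*η) ^ (i+1) / (i+1).factorial * (Q ^ i * Sg) := by gcongr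
        _ = 2 * η * Sg * ((2 * η * Q)^i * (1/(i+1).factorial)) := by rw [mul_pow (2*η) Q, pow_succ]; ring
        _ ≤ 2 * η * Sg * (1 * (1/2)^i) := by
            gcongr
            · exact pow_le_one₀ (by positivity) hQη
            · rw [one_div_pow]; gcongr
        _ = _ := by ring
    refine (Finset.sum_le_sum h1).trans ?_
    rw [← Finset.mul_sum]
    have h4 : ∑ i ∈ Finset.range K, (1/2:ℝ)^i ≤ 2 := by
      rw [geom_sum_eq (by norm_num)]
      have : (0:ℝ) ≤ (1/2)^K := by positivity
      rw [show ((1/2:ℝ)^K - 1)/(1/2-1) = 2 - 2*(1/2)^K by ring]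
      linarith
    have : 0 ≤ 2 * η * Sg := by positivity
    nlinarith

end MajorantPart

section FlowPart
variable {d : ℕ}

lemma rot_cont_joint {X : Type*} [TopologicalSpace X] (j k : Fin (d + 1)) (a : X → ℝ) (ha : Continuous a)
    (x : X → EuclideanSpace ℝ (Fin (d + 1))) (hx : Continuous x) : Continuous fun c => rot j k (a c) (x c) := by
  by_cases h : j = k
  · simpa [rot, h] using hx
  · have hc : ∀ i, Continuous fun c => x c i := fun i => (PiLp.continuous_apply 2 _ i).comp hx
    simp only [rot, h, if_false]
    refine (PiLp.continuous_toLp 2 _).comp (continuous_pi fun i => ?_)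
    have := hc j
    have := hc k
    have := hc i
    have := Real.continuous_cos.comp ha
    have := Real.continuous_sin.comp ha
    simp only [Function.comp_def] at *
    split_ifs <;> fun_prop

lemma coord_le (x : EuclideanSpace ℝ (Fin (d + 1))) (i : Fin (d+1)) : |x i| ≤ ‖x‖ := by
  simpa using PiLp.norm_apply_le x i

lemma rot_lip (j k : Fin (d + 1)) (s s' : ℝ) (x : EuclideanSpace ℝ (Fin (d + 1))) (hx : ‖x‖ = 1) :
    ‖rot j k s x - rot j k s' x‖ ≤ 4 * |s - s'| := by
  by_cases h : j = k
  · simp only [rot, h, if_true, sub_self, norm_zero]; positivity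
  have hj := coord_le x j
  have hk := coord_le x k
  rw [hx] at hj hk
  have hc : |Real.cos s - Real.cos s'| ≤ |s - s'| := by
    have := Real.lipschitzWith_cos.dist_le_mul s s'
    simpa [Real.dist_eq] using this
  have hs : |Real.sin s - Real.sin s'| ≤ |s - s'| := by
    have := Real.lipschitzWith_sin.dist_le_mul s s'
    simpa [Real.dist_eq] using this
  have key : ∀ A B u v r : ℝ, |A| ≤ r → |B| ≤ r → |u| ≤ 1 → |v| ≤ 1 → |A * u + B * v| ≤ 2 * r := by
    intro A B u v r hA hB hu hv
    have h1 : |A * u| ≤ r * 1 := by rw [abs_mul]; exact mul_le_mul hA hu (abs_nonneg _) ((abs_nonneg _).trans hA)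
    have h2 : |B * v| ≤ r * 1 := by rw [abs_mul]; exact mul_le_mul hB hv (abs_nonneg _) ((abs_nonneg _).trans hB)
    have := abs_add_le (A * u) (B * v)
    linarith
  have e : rot j k s x - rot j k s' x = 
      EuclideanSpace.single j ((Real.cos s - Real.cos s') * x j + (Real.sin s - Real.sin s') * (- x k)) + 
      EuclideanSpace.single k ((Real.sin s - Real.sin s') * x j + (Real.cos s - Real.cos s') * x k) := by
    ext i
    simp only [PiLp.sub_apply, PiLp.add_apply, rot_apply j k h, EuclideanSpace.single_apply]
    by_cases h1 : i = j
    · subst h1; simp only [if_true, h, if_false]; ring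
    · by_cases h2 : i = k
      · subst h2; simp only [if_true, h1, if_false]; ring
      · simp only [h1, h2, if_false]; ring
  rw [e]
  refine (norm_add_le _ _).trans ?_
  simp only [EuclideanSpace.norm_single, Real.norm_eq_abs]
  have h1 := key _ _ (x j) (- x k) _ hc hs hj (by rwa [abs_neg])
  have h2 := key _ _ (x j) (x k) _ hs hc hj hk
  linarith

lemma pe_lip (p : MvPolynomial (Fin (d + 1)) ℝ) : ∃ K : ℝ, 0 ≤ K ∧ (∀ x, ‖x‖ = 1 → |pe p x| ≤ K) ∧ 
    ∀ x y, ‖x‖ = 1 → ‖y‖ = 1 → |pe p x - pe p y| ≤ K * ‖x - y‖ := by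
  induction p using MvPolynomial.induction_on with
  | C a => 
    refine ⟨|a|, abs_nonneg _, fun x _ => by simp [pe], fun x y _ _ => ?_⟩
    simp only [pe, MvPolynomial.eval_C, sub_self, abs_zero]; positivity
  | add p q hp hq =>
    obtain ⟨K, hK0, hK1, hK2⟩ := hp
    obtain ⟨L, hL0, hL1, hL2⟩ := hq
    refine ⟨K + L, by positivity, fun x hx => ?_, fun x y hx hy => ?_⟩
    · rw [pe_add]; exact (abs_add_le _ _).trans (add_le_add (hK1 x hx) (hL1 x hx))
    · rw [pe_add, pe_add, add_sub_add_comm, add_mul]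
      exact (abs_add_le _ _).trans (add_le_add (hK2 x y hx hy) (hL2 x y hx hy))
  | mul_X p i hp =>
    obtain ⟨K, hK0, hK1, hK2⟩ := hp
    have hm : ∀ x, pe (p * MvPolynomial.X i) x = pe p x * x i := fun x => by simp [pe]
    refine ⟨2 * K, by positivity, fun x hx => ?_, fun x y hx hy => ?_⟩
    · rw [hm, abs_mul]
      have h1 := coord_le x i
      rw [hx] at h1
      have := mul_le_mul (hK1 x hx) h1 (abs_nonneg _) hK0
      linarith
    · rw [hm, hm, show pe p x * x i - pe p y * y i = (pe p x - pe p y) * x i + pe p y * (x i - y i) by ring]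
      have h1 := coord_le x i
      rw [hx] at h1
      have h2 := coord_le (x - y) i
      rw [PiLp.sub_apply] at h2
      have h3 := mul_le_mul (hK2 x y hx hy) h1 (abs_nonneg _) (by positivity)
      have h4 := mul_le_mul (hK1 y hy) h2 (abs_nonneg _) hK0
      rw [← abs_mul] at h3 h4
      have := abs_add_le ((pe p x - pe p y) * x i) (pe p y * (x i - y i))
      linarith

/-- truncation to `[-1,1]` -/
noncomputable def clp (u : ℝ) : ℝ := max (-1) (min 1 u)

lemma clp_cont : Continuous clp := by unfold clp; fun_prop

lemma clp_abs (u : ℝ) : |clp u| ≤ 1 := by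
  unfold clp
  rw [abs_le]
  exact ⟨le_max_left _ _, max_le (by norm_num) (min_le_left _ _)⟩

lemma clp_lip (u v : ℝ) : |clp u - clp v| ≤ |u - v| := by
  unfold clp
  rcases abs_cases (u - v) with ⟨h, h'⟩ | ⟨h, h'⟩ <;> rw [h, abs_le] <;> constructor <;>
  rcases max_cases (-1) (min 1 u) with ⟨h1, h2⟩ | ⟨h1, h2⟩ <;> 
  rcases max_cases (-1) (min 1 v) with ⟨h3, h4⟩ | ⟨h3, h4⟩ <;> rw [h1, h3] <;>
  rcases min_cases 1 u with ⟨h5, h6⟩ | ⟨h5, h6⟩ <;>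
  rcases min_cases 1 v with ⟨h7, h8⟩ | ⟨h7, h8⟩ <;> linarith

lemma clp_gain (g ε : ℝ) (hε : 0 < ε) : |g| - ε ≤ clp (g / ε) * g := by
  unfold clp
  by_cases h1 : ε ≤ g
  · have : 1 ≤ g / ε := (one_le_div hε).mpr h1
    rw [min_eq_left this, max_eq_right (by norm_num), abs_of_pos (by linarith)]; linarith
  · by_cases h2 : g ≤ -ε
    · have : g / ε ≤ -1 := by rw [div_le_iff₀ hε]; linarith
      rw [min_eq_right (by linarith), max_eq_left this, abs_of_neg (by linarith)]; linarith
    · push Not at h1 h2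
      have h3 : g / ε ≤ 1 := (div_le_one hε).mpr h1.le
      have h4 : -1 ≤ g / ε := by rw [le_div_iff₀ hε]; linarith
      rw [min_eq_right h3, max_eq_right h4]
      have h5 : |g| < ε := abs_lt.mpr ⟨h2, h1⟩
      have : 0 ≤ g / ε * g := by rw [div_mul_eq_mul_div]; exact div_nonneg (mul_self_nonneg g) hε.le
      linarith

/-- one step of the discrete flow -/
noncomputable def stp (h ε : ℝ) (P : MvPolynomial (Fin (d + 1)) ℝ) (q : Fin (d+1) × Fin (d+1)) 
    (x : EuclideanSpace ℝ (Fin (d + 1))) : EuclideanSpace ℝ (Fin (d + 1)) :=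
  rot q.1 q.2 (h * clp (pe (rL q.1 q.2 P) x / ε)) x

/-- discrete flow along a list of planes -/
noncomputable def flw (h ε : ℝ) (P : MvPolynomial (Fin (d + 1)) ℝ) : List (Fin (d+1) × Fin (d+1)) →
    EuclideanSpace ℝ (Fin (d + 1)) → EuclideanSpace ℝ (Fin (d + 1))
  | [], x => x
  | q :: l, x => flw h ε P l (stp h ε P q x)

lemma stp_norm (h ε : ℝ) (P : MvPolynomial (Fin (d + 1)) ℝ) (q : Fin (d+1) × Fin (d+1)) x : 
    ‖stp h ε P q x‖ = ‖x‖ := rot_norm _ _ _ _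

lemma flw_norm (h ε : ℝ) (P : MvPolynomial (Fin (d + 1)) ℝ) (l : List (Fin (d+1) × Fin (d+1))) :
    ∀ x, ‖flw h ε P l x‖ = ‖x‖ := by
  induction l with
  | nil => intro x; rfl
  | cons q l ih => intro x; rw [flw, ih, stp_norm]

lemma stp_inj (h ε : ℝ) (hh : 0 ≤ h) (hε : 0 < ε) (P : MvPolynomial (Fin (d + 1)) ℝ) (K : ℝ) 
    (hK : ∀ q : Fin (d+1) × Fin (d+1), ∀ x y, ‖x‖ = 1 → ‖y‖ = 1 → |pe (rL q.1 q.2 P) x - pe (rL q.1 q.2 P) y| ≤ K * ‖x - y‖)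
    (hhK : 4 * h * (K / ε) < 1) (q : Fin (d+1) × Fin (d+1)) (x y : EuclideanSpace ℝ (Fin (d + 1))) (hx : ‖x‖ = 1) (hy : ‖y‖ = 1)
    (hxy : stp h ε P q x = stp h ε P q y) : x = y := by
  set a := clp (pe (rL q.1 q.2 P) x / ε) with ha
  set b := clp (pe (rL q.1 q.2 P) y / ε) with hb
  have h1 : ‖x - y‖ = ‖rot q.1 q.2 (h * b) y - rot q.1 q.2 (h * a) y‖ := by
    rw [← rot_dist q.1 q.2 (h * a) x y]
    have : rot q.1 q.2 (h * a) x = rot q.1 q.2 (h * b) y := hxy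
    rw [this]
  have h2 := rot_lip q.1 q.2 (h * b) (h * a) y hy
  have h3 : |b - a| ≤ K / ε * ‖x - y‖ := by
    refine (clp_lip _ _).trans ?_
    rw [← sub_div, abs_div, abs_of_pos hε, div_mul_eq_mul_div]
    have := hK q y x hy hx
    rw [norm_sub_rev y x] at this
    gcongr
  rw [← mul_sub, abs_mul, abs_of_nonneg hh] at h2
  rw [← h1] at h2
  have h4 : ‖x - y‖ ≤ (4 * h * (K/ε)) * ‖x - y‖ := by
    refine h2.trans ?_
    have := mul_le_mul_of_nonneg_left h3 hh
    linarith
  by_contra hne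
  have : 0 < ‖x - y‖ := norm_pos_iff.mpr (sub_ne_zero.mpr hne)
  nlinarith

lemma flw_inj (h ε : ℝ) (hh : 0 ≤ h) (hε : 0 < ε) (P : MvPolynomial (Fin (d + 1)) ℝ) (K : ℝ) 
    (hK : ∀ q : Fin (d+1) × Fin (d+1), ∀ x y, ‖x‖ = 1 → ‖y‖ = 1 → |pe (rL q.1 q.2 P) x - pe (rL q.1 q.2 P) y| ≤ K * ‖x - y‖)
    (hhK : 4 * h * (K / ε) < 1) (l : List (Fin (d+1) × Fin (d+1))) : 
    ∀ (x y : EuclideanSpace ℝ (Fin (d + 1))), ‖x‖ = 1 → ‖y‖ = 1 → flw h ε P l x = flw h ε P l y → x = y := by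
  induction l with
  | nil => intro x y _ _ hxy; exact hxy
  | cons q l ih =>
    intro x y hx hy hxy
    exact stp_inj h ε hh hε P K hK hhK q x y hx hy 
      (ih _ _ (by rw [stp_norm, hx]) (by rw [stp_norm, hy]) hxy)

lemma stp_gain (h ε : ℝ) (hh : 0 ≤ h) (hε : 0 < ε) (P : MvPolynomial (Fin (d + 1)) ℝ) (q : Fin (d+1) × Fin (d+1)) 
    (x y : EuclideanSpace ℝ (Fin (d + 1))) (hx : ‖x‖ = 1) (η A : ℝ)
    (hA : ∀ z, ‖z‖ = 1 → ‖z - y‖ ≤ η → |pe (rL q.1 q.2 P) z - pe (rL q.1 q.2 P) y| ≤ A)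
    (hxy : ‖x - y‖ + 4 * h ≤ η) : 
    pe P x + h * (|pe (rL q.1 q.2 P) y| - 3 * A - ε) ≤ pe P (stp h ε P q x) := by
  set g := pe (rL q.1 q.2 P) x with hg
  set a := clp (g / ε) with ha
  have ha1 : |a| ≤ 1 := clp_abs _
  have hga : |g| - ε ≤ a * g := clp_gain g ε hε
  have hnear : ∀ s, |s| ≤ h → |pe (rL q.1 q.2 P) (rot q.1 q.2 s x) - pe (rL q.1 q.2 P) y| ≤ A := by
    intro s hs
    refine hA _ (by rw [rot_norm, hx]) ?_
    have h1 := rot_lip q.1 q.2 s 0 x hx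
    rw [rot_zero, sub_zero] at h1
    have h2 := norm_sub_le_norm_sub_add_norm_sub (rot q.1 q.2 s x) x y
    linarith
  have h0 := hnear 0 (by simpa using hh)
  rw [rot_zero, ← hg] at h0
  -- derivative in u of pe P (rot (u * (h a)) x) - u * h * a * g
  have hder : ∀ s, HasDerivAt (fun s => pe P (rot q.1 q.2 s x) - s * g) (pe (rL q.1 q.2 P) (rot q.1 q.2 s x) - g) s := fun s =>
    (rot_hasDerivAt P q.1 q.2 x s).sub (by simpa using (hasDerivAt_id s).mul_const g)
  have h3 := (convex_Icc (-h) h).norm_image_sub_le_of_norm_hasDerivWithin_le (C := 2 * A)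
    (fun s _ => (hder s).hasDerivWithinAt) (fun s hs => by
      have := hnear s (abs_le.mpr hs)
      rw [Real.norm_eq_abs, show pe (rL q.1 q.2 P) (rot q.1 q.2 s x) - g = 
        (pe (rL q.1 q.2 P) (rot q.1 q.2 s x) - pe (rL q.1 q.2 P) y) - (g - pe (rL q.1 q.2 P) y) by ring]
      refine (abs_sub _ _).trans ?_
      linarith) (x := 0) (y := h * a) ⟨by linarith, hh⟩ (by
        apply abs_le.mp
        rw [abs_mul, abs_of_nonneg hh]; nlinarith)
  simp only [rot_zero, zero_mul, sub_zero, Real.norm_eq_abs] at h3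
  have hA0 : 0 ≤ A := (abs_nonneg _).trans h0
  have h4 : |h * a| ≤ h := by rw [abs_mul, abs_of_nonneg hh]; nlinarith
  have h5 : 2 * A * |h * a| ≤ 2 * A * h := by gcongr
  have h6 := (abs_le.mp (h3.trans h5)).1
  have h7 : |pe (rL q.1 q.2 P) y| ≤ |g| + A := by
    have := abs_sub_abs_le_abs_sub (pe (rL q.1 q.2 P) y) g
    rw [abs_sub_comm] at this
    linarith
  have h8 : h * (|pe (rL q.1 q.2 P) y| - A - ε) ≤ h * (a * g) := mul_le_mul_of_nonneg_left (by linarith) hh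
  have e : stp h ε P q x = rot q.1 q.2 (h * a) x := rfl
  rw [e]
  linarith

lemma flw_gain (h ε : ℝ) (hh : 0 ≤ h) (hε : 0 < ε) (P : MvPolynomial (Fin (d + 1)) ℝ) 
    (y : EuclideanSpace ℝ (Fin (d + 1))) (η : ℝ) (A : Fin (d+1) × Fin (d+1) → ℝ)
    (hA : ∀ q z, ‖z‖ = 1 → ‖z - y‖ ≤ η → |pe (rL q.1 q.2 P) z - pe (rL q.1 q.2 P) y| ≤ A q) (l : List (Fin (d+1) × Fin (d+1))) : 
    ∀ x, ‖x‖ = 1 → ‖x - y‖ + 4 * h * l.length ≤ η →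
    pe P x + h * (l.map fun q => |pe (rL q.1 q.2 P) y| - 3 * A q - ε).sum ≤ pe P (flw h ε P l x) := by
  induction l with
  | nil => intro x _ _; simp [flw]
  | cons q l ih =>
    intro x hx hxy
    rw [List.length_cons] at hxy
    push_cast at hxy
    have hl : 0 ≤ 4 * h * (l.length : ℝ) := by positivity
    have h1 := stp_gain h ε hh hε P q x y hx η (A q) (hA q) (by linarith)
    have h2 : ‖stp h ε P q x - x‖ ≤ 4 * h := by
      have h1 := rot_lip q.1 q.2 (h * clp (pe (rL q.1 q.2 P) x / ε)) 0 x hx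
      rw [rot_zero, sub_zero, abs_mul, abs_of_nonneg hh] at h1
      have := clp_abs (pe (rL q.1 q.2 P) x / ε)
      refine h1.trans ?_
      nlinarith
    have h3 := norm_sub_le_norm_sub_add_norm_sub (stp h ε P q x) x y
    have h4 := ih (stp h ε P q x) (by rw [stp_norm, hx]) (by linarith)
    rw [List.map_cons, List.sum_cons, flw]
    linarith

lemma flw_cont {X : Type*} [TopologicalSpace X] (h ε : ℝ) (P : X → MvPolynomial (Fin (d + 1)) ℝ) 
    (hP : ∀ (q : Fin (d+1) × Fin (d+1)) (x : X → EuclideanSpace ℝ (Fin (d + 1))), Continuous x → 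
      Continuous fun c => pe (rL q.1 q.2 (P c)) (x c)) (l : List (Fin (d+1) × Fin (d+1))) : 
    ∀ x : X → EuclideanSpace ℝ (Fin (d + 1)), Continuous x → Continuous fun c => flw h ε (P c) l (x c) := by
  induction l with
  | nil => intro x hx; exact hx
  | cons q l ih =>
    intro x hx
    refine ih (fun c => stp h ε (P c) q (x c)) ?_
    refine rot_cont_joint _ _ _ ?_ _ hx
    exact continuous_const.mul (clp_cont.comp ((hP q x hx).div_const ε))

end FlowPart

section BasisPart
variable {d : ℕ}

lemma int_zero (f : EuclideanSpace ℝ (Fin (d + 1)) → ℝ) (hf : Continuous f) (h0 : ∀ x, 0 ≤ f x)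
    (hi : ∫ x, f x ∂(sphereMeasure d) = 0) (x : EuclideanSpace ℝ (Fin (d + 1))) (hx : ‖x‖ = 1) : f x = 0 := by
  by_contra hne
  have hpos : 0 < f x := lt_of_le_of_ne (h0 x) (Ne.symm hne)
  have hae : ∀ᵐ y ∂(sphereMeasure d), f y = 0 := (integral_eq_zero_iff_of_nonneg h0 (cont_int f hf)).mp hi
  obtain ⟨c, hc, hball⟩ := sm_ball d
  have hop : {y | 0 < f y} ∈ nhds x := (isOpen_lt continuous_const hf).mem_nhds hpos
  obtain ⟨r, hr, hsub⟩ := Metric.mem_nhds_iff.mp hop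
  have h1 := hball x hx (min r 1) (by positivity) (min_le_right _ _)
  have h2 : sphereMeasure d (Metric.ball x (min r 1)) = 0 := by
    refine measure_mono_null ?_ (ae_iff.mp hae)
    intro y hy
    have : 0 < f y := hsub (Metric.ball_subset_ball (min_le_left _ _) hy)
    exact this.ne'
  rw [h2] at h1
  have : 0 < c * (min r 1)^d := by positivity
  simp at h1
  linarith

lemma grad_zero (hd : 0 < d) (P : MvPolynomial (Fin (d + 1)) ℝ) (hP : ∫ x, pe P x ∂(sphereMeasure d) = 0)
    (h : ∀ q : Fin (d+1) × Fin (d+1), ∫ x, |pe (rL q.1 q.2 P) x| ∂(sphereMeasure d) = 0) 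
    (x : EuclideanSpace ℝ (Fin (d + 1))) (hx : ‖x‖ = 1) : pe P x = 0 := by
  have h1 : ∀ (q : Fin (d+1) × Fin (d+1)) y, ‖y‖ = 1 → pe (rL q.1 q.2 P) y = 0 := fun q y hy => by
    have := int_zero (fun x => |pe (rL q.1 q.2 P) x|) (pe_continuous _).abs (fun _ => abs_nonneg _) (h q) y hy
    simpa using this
  have h2 : ∀ z, ‖z‖ = 1 → z ≠ -x → pe P z = pe P x := by
    intro z hz hzx
    by_cases hxz : x = z
    · rw [hxz]
    obtain ⟨u, hu, hxu, θ, hθ0, hθ, hzθ⟩ := gc_exists x z hx hz hxz (fun h => hzx (by rw [h, neg_neg]))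
    have hder : ∀ s, HasDerivAt (fun θ => pe P (Real.cos θ • x + Real.sin θ • u)) 0 s := fun s => by
      refine (gc_hasDerivAt x u hx hu hxu P s).congr_deriv ?_
      rw [gcA, pe_sum]
      refine Finset.sum_eq_zero fun q _ => ?_
      rw [pe_smul, h1 q _ (gc_norm x u hx hu hxu s), mul_zero]
    have := is_const_of_deriv_eq_zero (fun s => (hder s).differentiableAt) (fun s => (hder s).deriv) θ 0
    simp only [← hzθ, Real.cos_zero, Real.sin_zero, one_smul, zero_smul, add_zero] at this
    exact this
  have h3 : ∀ᵐ z ∂(sphereMeasure d), z ≠ -x := by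
    rw [ae_iff]; simpa using sm_noatoms d hd (-x)
  have h4 : ∫ z, pe P z ∂(sphereMeasure d) = ∫ _z, pe P x ∂(sphereMeasure d) := by
    refine integral_congr_ae ?_
    filter_upwards [h3, sm_ae d] with z hz1 hz2
    exact h2 z hz2 hz1
  rw [hP] at h4
  simpa using h4.symm

lemma int_cont_param {n : ℕ} (f : EuclideanSpace ℝ (Fin n) → EuclideanSpace ℝ (Fin (d + 1)) → ℝ)
    (hf : Continuous f.uncurry) : Continuous fun c => ∫ x, f c x ∂(sphereMeasure d) := by
  have h := continuous_parametric_integral_of_continuous (μ := sphereMeasure d) hf 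
    (isCompact_sphere (0 : EuclideanSpace ℝ (Fin (d + 1))) 1)
  rwa [Measure.restrict_eq_self_of_ae_mem] at h
  filter_upwards [sm_ae d] with x hx
  simpa using hx

/-- polynomial from coefficients -/
noncomputable def Pc {n : ℕ} (b : Fin n → MvPolynomial (Fin (d + 1)) ℝ) (c : EuclideanSpace ℝ (Fin n)) : 
    MvPolynomial (Fin (d + 1)) ℝ := ∑ k, c k • b k

lemma pe_Pc {n : ℕ} (b : Fin n → MvPolynomial (Fin (d + 1)) ℝ) (c : EuclideanSpace ℝ (Fin n)) x : 
    pe (Pc b c) x = ∑ k, c k * pe (b k) x := by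
  rw [Pc, pe_sum]; exact Finset.sum_congr rfl fun k _ => pe_smul _ _ _

lemma pe_rL_Pc {n : ℕ} (b : Fin n → MvPolynomial (Fin (d + 1)) ℝ) (i j) (c : EuclideanSpace ℝ (Fin n)) x : 
    pe (rL i j (Pc b c)) x = ∑ k, c k * pe (rL i j (b k)) x := by
  rw [Pc, rL_sum, pe_sum]; exact Finset.sum_congr rfl fun k _ => by rw [rL_smul, pe_smul]

lemma pe_rL_cont {X : Type*} [TopologicalSpace X] {n : ℕ} (b : Fin n → MvPolynomial (Fin (d + 1)) ℝ) (i j) 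
    (c : X → EuclideanSpace ℝ (Fin n)) (hc : Continuous c) (x : X → EuclideanSpace ℝ (Fin (d + 1))) (hx : Continuous x) :
    Continuous fun a => pe (rL i j (Pc b (c a))) (x a) := by
  simp_rw [pe_rL_Pc]
  exact continuous_finsetSum _ fun k _ => ((PiLp.continuous_apply 2 _ k).comp hc).mul ((pe_continuous _).comp hx)

/-- the L1 gradient norm -/
noncomputable def Mn {n : ℕ} (b : Fin n → MvPolynomial (Fin (d + 1)) ℝ) (c : EuclideanSpace ℝ (Fin n)) : ℝ :=
  ∑ q : Fin (d+1) × Fin (d+1), ∫ x, |pe (rL q.1 q.2 (Pc b c)) x| ∂(sphereMeasure d)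

lemma Mn_cont {n : ℕ} (b : Fin n → MvPolynomial (Fin (d + 1)) ℝ) : Continuous (Mn b) := by
  unfold Mn
  refine continuous_finsetSum _ fun q _ => int_cont_param _ ?_
  exact (pe_rL_cont b q.1 q.2 (fun a : EuclideanSpace ℝ (Fin n) × EuclideanSpace ℝ (Fin (d + 1)) => a.1) continuous_fst 
    (fun a => a.2) continuous_snd).abs

lemma Mn_hom {n : ℕ} (b : Fin n → MvPolynomial (Fin (d + 1)) ℝ) (a : ℝ) (c : EuclideanSpace ℝ (Fin n)) : 
    Mn b (a • c) = |a| * Mn b c := by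
  unfold Mn
  rw [Finset.mul_sum]
  refine Finset.sum_congr rfl fun q _ => ?_
  rw [← integral_const_mul]
  congr 1; ext x
  rw [← abs_mul, pe_rL_Pc, pe_rL_Pc, Finset.mul_sum]
  congr 1
  exact Finset.sum_congr rfl fun k _ => by simp [mul_assoc]

lemma basis_exists (d t : ℕ) : ∃ (n : ℕ) (b : Fin n → MvPolynomial (Fin (d + 1)) ℝ), 
    (∀ k, (b k).totalDegree ≤ t) ∧ (∀ k, ∫ x, pe (b k) x ∂(sphereMeasure d) = 0) ∧ 
    (∀ c : EuclideanSpace ℝ (Fin n), (∀ x, ‖x‖ = 1 → pe (Pc b c) x = 0) → c = 0) ∧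
    (∀ p : MvPolynomial (Fin (d + 1)) ℝ, p.totalDegree ≤ t → ∃ c : EuclideanSpace ℝ (Fin n), 
      ∀ x, ‖x‖ = 1 → pe p x = ∫ y, pe p y ∂(sphereMeasure d) + pe (Pc b c) x) := by
  let Il : MvPolynomial (Fin (d + 1)) ℝ →ₗ[ℝ] ℝ := 
    { toFun := fun p => ∫ y, pe p y ∂(sphereMeasure d)
      map_add' := fun p q => by
        simp only [pe_add]; exact integral_add (cont_int _ (pe_continuous p)) (cont_int _ (pe_continuous q))
      map_smul' := fun a p => by
        simp only [pe_smul]; exact integral_const_mul _ _ }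
  let Φ : MvPolynomial (Fin (d + 1)) ℝ →ₗ[ℝ] (Metric.sphere (0 : EuclideanSpace ℝ (Fin (d + 1))) 1 → ℝ) := 
    { toFun := fun p x => pe p x
      map_add' := fun p q => by ext x; simp [pe_add]
      map_smul' := fun a p => by ext x; simp [pe_smul] }
  let V0 := MvPolynomial.restrictTotalDegree (Fin (d+1)) ℝ t ⊓ LinearMap.ker Il
  haveI : FiniteDimensional ℝ V0 := Submodule.finiteDimensional_inf_left _ _
  let V := V0.map Φ
  haveI : FiniteDimensional ℝ V := inferInstance
  let B := Module.finBasis ℝ V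
  have hl : ∀ k, ∃ p ∈ V0, Φ p = B k := fun k => Submodule.mem_map.mp (B k).2
  choose b hb hbB using hl
  have hPc : ∀ c : EuclideanSpace ℝ (Fin (Module.finrank ℝ V)), Φ (Pc b c) = ((∑ k, c k • B k : V) : _ → ℝ) := by
    intro c
    rw [Pc, map_sum]
    simp [hbB]
  refine ⟨_, b, fun k => (MvPolynomial.mem_restrictTotalDegree _ _ _).mp (hb k).1, fun k => LinearMap.mem_ker.mp (hb k).2, ?_, ?_⟩
  · intro c hc
    have h1 : Φ (Pc b c) = 0 := by
      ext x; exact hc x (by simpa using x.2)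
    rw [hPc] at h1
    have h2 : (∑ k, c k • B k : V) = 0 := Subtype.ext h1
    have h3 := Fintype.linearIndependent_iff.mp B.linearIndependent (fun k => c k) h2
    ext k; exact h3 k
  · intro p hp
    set a := ∫ y, pe p y ∂(sphereMeasure d) with ha
    have hm : p - MvPolynomial.C a ∈ V0 := by
      refine ⟨(MvPolynomial.mem_restrictTotalDegree _ _ _).mpr ?_, LinearMap.mem_ker.mpr ?_⟩
      · refine (MvPolynomial.totalDegree_sub _ _).trans ?_
        simpa using hp
      · rw [map_sub, sub_eq_zero]
        change a = ∫ y, pe (MvPolynomial.C a) y ∂(sphereMeasure d)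
        simp [pe]
    have hm' : Φ (p - MvPolynomial.C a) ∈ V := Submodule.mem_map_of_mem hm
    refine ⟨WithLp.toLp 2 (fun k => B.repr ⟨_, hm'⟩ k), fun x hx => ?_⟩
    have h1 := hPc (WithLp.toLp 2 (fun k => B.repr ⟨_, hm'⟩ k))
    simp only [B.sum_repr] at h1
    have h2 := congrFun h1 ⟨x, by simpa using hx⟩
    have h3 : pe (Pc b (WithLp.toLp 2 (fun k => B.repr ⟨_, hm'⟩ k))) x = pe (p - MvPolynomial.C a) x := h2
    rw [h3]
    simp [pe]

lemma Pc_int {n : ℕ} (b : Fin n → MvPolynomial (Fin (d + 1)) ℝ) (hb : ∀ k, ∫ x, pe (b k) x ∂(sphereMeasure d) = 0)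
    (c : EuclideanSpace ℝ (Fin n)) : ∫ x, pe (Pc b c) x ∂(sphereMeasure d) = 0 := by
  simp_rw [pe_Pc]
  rw [integral_finsetSum _ fun k _ => cont_int (fun x => c k * pe (b k) x) (continuous_const.mul (pe_continuous _))]
  exact Finset.sum_eq_zero fun k _ => by rw [integral_const_mul, hb, mul_zero]

lemma Pc_deg {n : ℕ} (t : ℕ) (b : Fin n → MvPolynomial (Fin (d + 1)) ℝ) (hb : ∀ k, (b k).totalDegree ≤ t) 
    (c : EuclideanSpace ℝ (Fin n)) : (Pc b c).totalDegree ≤ t := by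
  rw [← MvPolynomial.mem_restrictTotalDegree]
  exact Submodule.sum_mem _ fun k _ => Submodule.smul_mem _ _ ((MvPolynomial.mem_restrictTotalDegree _ _ _).mpr (hb k))

lemma Mn_pos {n : ℕ} (hd : 0 < d) (b : Fin n → MvPolynomial (Fin (d + 1)) ℝ) 
    (hb : ∀ k, ∫ x, pe (b k) x ∂(sphereMeasure d) = 0)
    (hli : ∀ c : EuclideanSpace ℝ (Fin n), (∀ x, ‖x‖ = 1 → pe (Pc b c) x = 0) → c = 0) 
    (c : EuclideanSpace ℝ (Fin n)) (hc : c ≠ 0) : 0 < Mn b c := by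
  have h0 : ∀ q ∈ (Finset.univ : Finset (Fin (d+1) × Fin (d+1))), 0 ≤ ∫ x, |pe (rL q.1 q.2 (Pc b c)) x| ∂(sphereMeasure d) := 
    fun q _ => integral_nonneg fun x => abs_nonneg _
  refine lt_of_le_of_ne (Finset.sum_nonneg h0) fun h => hc (hli c fun x hx => ?_)
  exact grad_zero hd _ (Pc_int b hb c) (fun q => (Finset.sum_eq_zero_iff_of_nonneg h0).mp h.symm q (Finset.mem_univ _)) x hx

lemma unif_lip {n : ℕ} (hd : 0 < d) (b : Fin n → MvPolynomial (Fin (d + 1)) ℝ) 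
    (hb : ∀ k, ∫ x, pe (b k) x ∂(sphereMeasure d) = 0)
    (hli : ∀ c : EuclideanSpace ℝ (Fin n), (∀ x, ‖x‖ = 1 → pe (Pc b c) x = 0) → c = 0) :
    ∃ K : ℝ, 0 ≤ K ∧ ∀ c : EuclideanSpace ℝ (Fin n), Mn b c ≤ 1 → ∀ q : Fin (d+1) × Fin (d+1), ∀ x y, ‖x‖ = 1 → ‖y‖ = 1 →
      |pe (rL q.1 q.2 (Pc b c)) x - pe (rL q.1 q.2 (Pc b c)) y| ≤ K * ‖x - y‖ := by
  obtain ⟨μ, hμ, hμM⟩ := (isCompact_sphere (0 : EuclideanSpace ℝ (Fin n)) 1).exists_forall_le' (Mn_cont b).continuousOn (a := 0)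
    (fun c hc => Mn_pos hd b hb hli c (by rintro rfl; simp at hc))
  have hbd : ∀ c : EuclideanSpace ℝ (Fin n), Mn b c ≤ 1 → ‖c‖ ≤ μ⁻¹ := by
    intro c hc
    by_cases h0 : c = 0
    · rw [h0, norm_zero]; positivity
    have hn : 0 < ‖c‖ := norm_pos_iff.mpr h0
    have h1 := hμM (‖c‖⁻¹ • c) (by simp [norm_smul, hn.ne'])
    rw [Mn_hom, abs_of_pos (by positivity)] at h1
    have h2 : ‖c‖⁻¹ * Mn b c ≤ ‖c‖⁻¹ * 1 := by gcongr
    rw [le_inv_comm₀ hn hμ]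
    linarith
  choose K hK0 hK1 hK2 using fun (q : Fin (d+1) × Fin (d+1)) (k : Fin n) => pe_lip (rL q.1 q.2 (b k))
  refine ⟨∑ q, ∑ k, μ⁻¹ * K q k, Finset.sum_nonneg fun q _ => Finset.sum_nonneg fun k _ => mul_nonneg (by positivity) (hK0 q k), ?_⟩
  intro c hc q x y hx hy
  rw [pe_rL_Pc, pe_rL_Pc, ← Finset.sum_sub_distrib]
  have h1 : ∑ k, μ⁻¹ * K q k ≤ ∑ q, ∑ k, μ⁻¹ * K q k := 
    Finset.single_le_sum (f := fun q => ∑ k, μ⁻¹ * K q k) (fun q _ => Finset.sum_nonneg fun k _ => mul_nonneg (by positivity) (hK0 q k)) (Finset.mem_univ q)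
  refine le_trans ?_ (mul_le_mul_of_nonneg_right h1 (norm_nonneg _))
  rw [Finset.sum_mul]
  refine (Finset.abs_sum_le_sum_abs _ _).trans (Finset.sum_le_sum fun k _ => ?_)
  rw [← mul_sub, abs_mul, mul_assoc]
  have h2 : |c k| ≤ ‖c‖ := by simpa using PiLp.norm_apply_le c k
  exact mul_le_mul (h2.trans (hbd c hc)) (hK2 q k x y hx hy) (abs_nonneg _) (by positivity)

end BasisPart

section AssemblyPart
variable {d : ℕ}

/-- the list of planes, repeated `m` times -/
noncomputable def pl (d m : ℕ) : List (Fin (d+1) × Fin (d+1)) := 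
  (List.replicate m (Finset.univ : Finset (Fin (d+1) × Fin (d+1))).toList).flatten

lemma pl_length (m : ℕ) : ((pl d m).length : ℝ) = m * ((d:ℝ)+1)^2 := by
  simp [pl, List.length_flatten]; left; ring

lemma pl_sum (m : ℕ) (φ : Fin (d+1) × Fin (d+1) → ℝ) : ((pl d m).map φ).sum = m * ∑ q, φ q := by
  unfold pl
  induction m with
  | zero => simp
  | succ m ih =>
    rw [List.replicate_succ, List.flatten_cons, List.map_append, List.sum_append, ih]
    rw [Finset.sum_map_toList]; push_cast; ring

lemma positivity_key (t : ℕ) (ht : 0 < t) (P : MvPolynomial (Fin (d + 1)) ℝ) (hP : P.totalDegree ≤ t)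
    (hP0 : ∫ x, pe P x ∂(sphereMeasure d) = 0)
    (hM : ∑ q : Fin (d+1) × Fin (d+1), ∫ x, |pe (rL q.1 q.2 P) x| ∂(sphereMeasure d) = 1) (δ : ℝ) 
    (hδ : δ = (10000 * (((d:ℝ)+1)^2)^2 * t)⁻¹) (m : ℕ) (h ε : ℝ) (hh : 0 ≤ h) (hmh : m * h = 16 * δ)
    (hε : ε = (16 * ((d:ℝ)+1)^2)⁻¹) (N : ℕ) (hN : 0 < N) (x : Fin N → EuclideanSpace ℝ (Fin (d + 1))) (hx : ∀ i, ‖x i‖ = 1)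
    (hpart : ∀ f : EuclideanSpace ℝ (Fin (d + 1)) → ℝ, Continuous f → ∀ G : Fin N → ℝ, 
      (∀ i y, ‖y‖ = 1 → ‖y - x i‖ ≤ δ → f y ≤ G i) → (N:ℝ) * ∫ y, f y ∂(sphereMeasure d) ≤ ∑ i, G i) :
    0 < ∑ i, pe P (flw h ε P (pl d m) (x i)) := by
  set D : ℝ := ((d:ℝ)+1)^2 with hD
  have hD1 : 1 ≤ D := by rw [hD]; have : (0:ℝ) ≤ d := by positivity
                         nlinarith
  have ht1 : (1:ℝ) ≤ t := by exact_mod_cast ht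
  have hX : 0 < 10000 * D ^ 2 * (t:ℝ) := by positivity
  have hδ0 : 0 < δ := by rw [hδ]; positivity
  have hε0 : 0 < ε := by rw [hε]; positivity
  have hδX : δ * (10000 * D ^ 2 * (t:ℝ)) = 1 := by rw [hδ]; exact inv_mul_cancel₀ hX.ne'
  have hDε : D * ε = 1/16 := by rw [hε]; field_simp
  clear_value D
  set η : ℝ := 65 * D * δ with hη
  have hη0 : 0 < η := by positivity
  have hηDt : 24 * η * D * t ≤ 1/4 := by rw [hη]; nlinarith
  have hDt : 1 ≤ D * t := by nlinarith
  have hη1 : η ≤ 1 := by nlinarith [mul_le_mul_of_nonneg_left hDt hη0.le]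
  have hδη : δ ≤ η := by rw [hη]; nlinarith
  have hδDt : 4 * δ * t * D ≤ 1 := by
    have : δ * (D * t) ≤ η * (D * t) := by gcongr
    linarith
  obtain ⟨A0, hA0c, hA0n, hA0, hA0i⟩ := majorant t ht P hP δ hδ0 (hδη.trans hη1) (by rw [← hD]; exact hδDt) δ hδ0
  have hmaj := fun q : Fin (d+1) × Fin (d+1) => majorant t ht (rL q.1 q.2 P) ((rL_degree _ _ _).trans hP) η hη0 hη1 
    (by rw [← hD]; linarith) ε hε0
  choose A hAc hAn hA hAi using hmaj
  rw [hM] at hA0i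
  have hAi' : ∀ q : Fin (d+1) × Fin (d+1), ∫ y, A q y ∂(sphereMeasure d) ≤ 
      8 * η * D * t * ∫ y, |pe (rL q.1 q.2 P) y| ∂(sphereMeasure d) + ε := by
    intro q
    refine (hAi q).trans ?_
    have : ∑ q' : Fin (d+1) × Fin (d+1), ∫ x, |pe (rL q'.1 q'.2 (rL q.1 q.2 P)) x| ∂(sphereMeasure d) ≤ 
        ∑ _q' : Fin (d+1) × Fin (d+1), 2 * t * ∫ y, |pe (rL q.1 q.2 P) y| ∂(sphereMeasure d) := 
      Finset.sum_le_sum fun q' _ => bern_L1 t ht _ ((rL_degree _ _ _).trans hP) _ _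
    simp only [Finset.sum_const, Finset.card_univ, Fintype.card_prod, Fintype.card_fin, nsmul_eq_mul] at this
    push_cast at this
    rw [← sq, ← hD] at this
    have := mul_le_mul_of_nonneg_left this (by positivity : 0 ≤ 4 * η)
    linarith
  have hAsum : ∑ q, ∫ y, A q y ∂(sphereMeasure d) ≤ 8 * η * D * t + D * ε := by
    refine (Finset.sum_le_sum fun q _ => hAi' q).trans (le_of_eq ?_)
    rw [Finset.sum_add_distrib, ← Finset.mul_sum, hM]
    simp only [Finset.sum_const, Finset.card_univ, Fintype.card_prod, Fintype.card_fin, nsmul_eq_mul]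
    push_cast
    rw [← sq, ← hD]; ring
  have hfq : ∀ q : Fin (d+1) × Fin (d+1), Continuous fun y => |pe (rL q.1 q.2 P) y| - 3 * A q y - ε := fun q =>
    ((pe_continuous _).abs.sub (continuous_const.mul (hAc q))).sub continuous_const
  have hfs : Continuous fun y => ∑ q : Fin (d+1) × Fin (d+1), (|pe (rL q.1 q.2 P) y| - 3 * A q y - ε) :=
    continuous_finsetSum _ fun q _ => hfq q
  have hf : Continuous fun y => pe P y - A0 y + 16 * δ * ∑ q : Fin (d+1) × Fin (d+1), (|pe (rL q.1 q.2 P) y| - 3 * A q y - ε) :=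
    ((pe_continuous P).sub hA0c).add (continuous_const.mul hfs)
  have hmain := hpart _ hf (fun i => pe P (flw h ε P (pl d m) (x i))) (fun i y hy hyx => by
    have h1 := flw_gain h ε hh hε0 P y η (fun q => A q y) (fun q z hz hzy => hA q y z hy hz hzy) (pl d m) (x i) (hx i) (by
      rw [pl_length, ← hD, norm_sub_rev]
      rw [show 4 * h * (m * D) = 4 * D * (m * h) by ring, hmh, hη]
      nlinarith)
    rw [pl_sum, ← mul_assoc, mul_comm h, hmh] at h1
    have h2 := (abs_le.mp (hA0 y (x i) hy (hx i) (by rwa [norm_sub_rev]))).1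
    linarith)
  refine lt_of_lt_of_le ?_ hmain
  refine mul_pos (by exact_mod_cast hN) ?_
  rw [integral_add (cont_int (fun y => pe P y - A0 y) ((pe_continuous P).sub hA0c)) (cont_int (fun y => 16 * δ * ∑ q : Fin (d+1) × Fin (d+1), (|pe (rL q.1 q.2 P) y| - 3 * A q y - ε)) (continuous_const.mul hfs)), 
    integral_sub (cont_int _ (pe_continuous P)) (cont_int _ hA0c), integral_const_mul, 
    integral_finsetSum _ fun q _ => cont_int _ (hfq q), hP0]
  have h3 : ∀ q : Fin (d+1) × Fin (d+1), ∫ y, (|pe (rL q.1 q.2 P) y| - 3 * A q y - ε) ∂(sphereMeasure d) = 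
      ∫ y, |pe (rL q.1 q.2 P) y| ∂(sphereMeasure d) - 3 * ∫ y, A q y ∂(sphereMeasure d) - ε := by
    intro q
    rw [integral_sub (cont_int (fun y => |pe (rL q.1 q.2 P) y| - 3 * A q y) 
        ((pe_continuous _).abs.sub (continuous_const.mul (hAc q)))) (integrable_const _),
      integral_sub (cont_int _ (pe_continuous _).abs) (cont_int (fun y => 3 * A q y) (continuous_const.mul (hAc q))), integral_const_mul]
    simp
  have h4 : ∑ q : Fin (d+1) × Fin (d+1), ∫ y, (|pe (rL q.1 q.2 P) y| - 3 * A q y - ε) ∂(sphereMeasure d) = 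
      1 - 3 * ∑ q, ∫ y, A q y ∂(sphereMeasure d) - D * ε := by
    simp_rw [h3]
    rw [Finset.sum_sub_distrib, Finset.sum_sub_distrib, hM, ← Finset.mul_sum]
    simp only [Finset.sum_const, Finset.card_univ, Fintype.card_prod, Fintype.card_fin, nsmul_eq_mul]
    push_cast
    rw [← sq, ← hD]
  rw [h4]
  have h5 : 1/2 ≤ 1 - 3 * ∑ q, ∫ y, A q y ∂(sphereMeasure d) - D * ε := by linarith
  have h6 := mul_le_mul_of_nonneg_left h5 (by positivity : 0 ≤ 16 * δ)
  linarith

theorem main_exists (d : ℕ) (hd : 2 ≤ d) :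
    ∃ C : ℝ, 0 < C ∧ ∀ t N : ℕ, 0 < t → C * (t : ℝ) ^ d ≤ (N : ℝ) →
      ∃ X : Finset (EuclideanSpace ℝ (Fin (d + 1))),
        X.card = N ∧ (∀ x ∈ X, ‖x‖ = 1) ∧ IsSphericalDesign d t X := by
  obtain ⟨c0, hc0, hpart⟩ := partition_lemma d hd
  have hd0 : 0 < d := by omega
  refine ⟨c0 * (10000 * (((d:ℝ)+1)^2)^2) ^ d, by positivity, ?_⟩
  intro t N ht hN
  have ht1 : (1:ℝ) ≤ t := by exact_mod_cast ht
  have ht0 : (0:ℝ) < t := by linarith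
  obtain ⟨δ, hδ⟩ : ∃ δ : ℝ, δ = (10000 * (((d:ℝ)+1)^2)^2 * t)⁻¹ := ⟨_, rfl⟩
  obtain ⟨ε, hε⟩ : ∃ ε : ℝ, ε = (16 * ((d:ℝ)+1)^2)⁻¹ := ⟨_, rfl⟩
  have hδ0 : 0 < δ := by rw [hδ]; positivity
  have hε0 : 0 < ε := by rw [hε]; positivity
  have hδ1 : δ ≤ 1 := by
    rw [hδ]
    apply inv_le_one_of_one_le₀
    have h1 : (1:ℝ) ≤ ((d:ℝ)+1)^2 := one_le_pow₀ (by linarith [(Nat.cast_nonneg d : (0:ℝ) ≤ d)])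
    have h2 : (1:ℝ) ≤ (((d:ℝ)+1)^2)^2 := one_le_pow₀ h1
    nlinarith
  have hN' : c0 * (δ⁻¹)^d ≤ N := by
    rw [hδ, inv_inv, mul_pow]; rw [mul_assoc] at hN; exact hN
  have hN0 : 0 < N := by
    have : (0:ℝ) < N := lt_of_lt_of_le (by positivity) hN'
    exact_mod_cast this
  obtain ⟨x, hxinj, hx1, hxf⟩ := hpart δ hδ0 hδ1 N hN'
  obtain ⟨n, b, hbd, hb0, hbli, hbspan⟩ := basis_exists d t
  obtain ⟨K, hK0, hK⟩ := unif_lip hd0 b hb0 hbli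
  obtain ⟨m, hm⟩ := exists_nat_gt (4 * (16 * δ) * (K / ε))
  have hm0 : (0:ℝ) < m := lt_of_le_of_lt (by positivity) hm
  obtain ⟨h, hh⟩ : ∃ h : ℝ, h = 16 * δ / m := ⟨_, rfl⟩
  have hh0 : 0 ≤ h := by rw [hh]; positivity
  have hmh : m * h = 16 * δ := by rw [hh]; field_simp
  have hhK : 4 * h * (K / ε) < 1 := by
    rw [hh, show 4 * (16 * δ / m) * (K / ε) = (4 * (16 * δ) * (K / ε)) / m by ring, div_lt_one hm0]; exact hm
  have hflc : ∀ i, Continuous fun c => flw h ε (Pc b c) (pl d m) (x i) := fun i =>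
    flw_cont h ε (fun c => Pc b c) (fun q y hy => pe_rL_cont b q.1 q.2 _ continuous_id _ hy) (pl d m) (fun _ => x i) continuous_const
  obtain ⟨c, hcM, hc⟩ := bz_star_zero 
    (fun c => WithLp.toLp 2 fun k => ∑ i, pe (b k) (flw h ε (Pc b c) (pl d m) (x i)))
    ((PiLp.continuous_toLp 2 _).comp (continuous_pi fun k => continuous_finsetSum _ fun i _ => (pe_continuous _).comp (hflc i)))
    (Mn b) (Mn_cont b) (Mn_hom b) (Mn_pos hd0 b hb0 hbli) (by
      intro c hc
      have h1 := positivity_key t ht (Pc b c) (Pc_deg t b hbd c) (Pc_int b hb0 c) hc δ hδ m h ε hh0 hmh hε N hN0 x hx1 hxf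
      refine lt_of_lt_of_eq h1 ?_
      rw [PiLp.inner_apply]
      simp_rw [pe_Pc]
      rw [Finset.sum_comm]
      refine Finset.sum_congr rfl fun k _ => ?_
      rw [← Finset.mul_sum]
      simp [mul_comm])
  have hz : ∀ k, ∑ i, pe (b k) (flw h ε (Pc b c) (pl d m) (x i)) = 0 := fun k => by
    have := congrArg (fun v : EuclideanSpace ℝ (Fin n) => v k) hc
    simpa using this
  have hinj : Function.Injective fun i => flw h ε (Pc b c) (pl d m) (x i) := fun i j hij =>
    hxinj (flw_inj h ε hh0 hε0 (Pc b c) K (hK c hcM) hhK (pl d m) _ _ (hx1 i) (hx1 j) hij)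
  have hcard : (Finset.univ.map ⟨_, hinj⟩).card = N := by simp
  refine ⟨Finset.univ.map ⟨_, hinj⟩, hcard, ?_, ?_⟩
  · intro y hy
    rw [Finset.mem_map] at hy
    obtain ⟨i, _, rfl⟩ := hy
    exact (flw_norm _ _ _ _ _).trans (hx1 i)
  · intro p hp
    rw [hcard, Finset.sum_map]
    obtain ⟨r, hr⟩ := hbspan p hp
    change (N:ℝ)⁻¹ * ∑ i, pe p (flw h ε (Pc b c) (pl d m) (x i)) = ∫ y, pe p y ∂(sphereMeasure d)
    have h1 : ∑ i, pe p (flw h ε (Pc b c) (pl d m) (x i)) = N * ∫ y, pe p y ∂(sphereMeasure d) := by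
      calc _ = ∑ i, (∫ y, pe p y ∂(sphereMeasure d) + pe (Pc b r) (flw h ε (Pc b c) (pl d m) (x i))) :=
            Finset.sum_congr rfl fun i _ => hr _ ((flw_norm _ _ _ _ _).trans (hx1 i))
        _ = N * ∫ y, pe p y ∂(sphereMeasure d) + ∑ i, ∑ k, r k * pe (b k) (flw h ε (Pc b c) (pl d m) (x i)) := by
            rw [Finset.sum_add_distrib]; simp [pe_Pc]
        _ = _ := by
            rw [Finset.sum_comm]
            simp_rw [← Finset.mul_sum, hz]
            simp
    rw [h1, ← mul_assoc, inv_mul_cancel₀ (by exact_mod_cast hN0.ne'), one_mul]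

end AssemblyPart

/-- Bondarenko–Radchenko–Viazovska: for every `d ≥ 2` there is a constant
`C_d > 0` such that for every `t ≥ 1` and every `N ≥ C_d t^d` there exists a spherical
`t`-design on `S^d` with exactly `N` points. -/
theorem exists_spherical_design_optimal_order (d : ℕ) (hd : 2 ≤ d) :
    ∃ C : ℝ, 0 < C ∧ ∀ t N : ℕ, 0 < t → C * (t : ℝ) ^ d ≤ (N : ℝ) →
      ∃ X : Finset (EuclideanSpace ℝ (Fin (d + 1))),
        X.card = N ∧ (∀ x ∈ X, ‖x‖ = 1) ∧ IsSphericalDesign d t X := by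
  exact main_exists d hd
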